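/- arXiv:0906.2935 — 9 statements merged into one kernel-verified Lean document; each statement's English description precedes it below -/
import Mathlib

section
/- Let q̄ be a prime power. The numerical semigroup generated by the three integers q̄³−q̄²+q̄, q̄³ and q̄³+1 (i.e., the additive submonoid of ℕ generated by these elements) has exactly g gaps, where g is determined by 2g = (q̄³+1)(q̄²−2) + 2. Equivalently, the set of natural numbers not belonging to this submonoid is finite of cardinality ((q̄³+1)(q̄²−2))/2 + 1. -/
/-- If `S` is symmetric about `F / 2` and contains everything above `F`, then exactly half of the
numbers `0, …, F` are missing from `S`. -/
theorem finite_compl_and_two_mul_ncard_of_symmetric {S : Set ℕ} {F : ℕ}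
    (hsymm : ∀ a b, a + b = F → (a ∉ S ↔ b ∈ S)) (hlarge : ∀ n, F < n → n ∈ S) :
    {n | n ∉ S}.Finite ∧ 2 * {n | n ∉ S}.ncard = F + 1 := by
  classical
  have hset : {n | n ∉ S} = ↑((Finset.range (F + 1)).filter (· ∉ S)) := by
    ext n
    simp only [Set.mem_ofPred_eq, Finset.coe_filter, Finset.mem_range]
    refine ⟨fun h => ⟨?_, h⟩, fun h => h.2⟩
    by_contra hn
    exact h (hlarge n (by omega))
  have hcard : ((Finset.range (F + 1)).filter (· ∉ S)).card =
      ((Finset.range (F + 1)).filter (· ∈ S)).card := by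
    refine Finset.card_nbij' (F - ·) (F - ·) ?_ ?_ ?_ ?_
    · intro n hn
      simp only [Finset.coe_filter, Finset.mem_range, Set.mem_ofPred_eq] at hn ⊢
      exact ⟨by omega, (hsymm n (F - n) (by omega)).1 hn.2⟩
    · intro n hn
      simp only [Finset.coe_filter, Finset.mem_range, Set.mem_ofPred_eq] at hn ⊢
      exact ⟨by omega, (hsymm (F - n) n (by omega)).2 hn.2⟩
    · intro n hn
      simp only [Finset.coe_filter, Finset.mem_range, Set.mem_ofPred_eq] at hn
      dsimp only
      omega
    · intro n hn
      simp only [Finset.coe_filter, Finset.mem_range, Set.mem_ofPred_eq] at hn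
      dsimp only
      omega
  have hsum := Finset.card_filter_add_card_filter_not (s := Finset.range (F + 1)) (· ∈ S)
  rw [Finset.card_range] at hsum
  rw [hset, Set.ncard_coe_finset]
  exact ⟨Finset.finite_toSet _, by omega⟩

theorem AddSubmonoid.mem_closure_triple_nat {a b c n : ℕ} :
    n ∈ AddSubmonoid.closure ({a, b, c} : Set ℕ) ↔ ∃ x y z, n = x * a + y * b + z * c := by
  constructor
  · intro h
    induction h using AddSubmonoid.closure_induction with
    | mem n hn =>
      rcases hn with rfl | rfl | rfl
      · exact ⟨1, 0, 0, by simp⟩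
      · exact ⟨0, 1, 0, by simp⟩
      · exact ⟨0, 0, 1, by simp⟩
    | zero => exact ⟨0, 0, 0, by simp⟩
    | add m n _ _ hm hn =>
      obtain ⟨x, y, z, rfl⟩ := hm
      obtain ⟨x', y', z', rfl⟩ := hn
      exact ⟨x + x', y + y', z + z', by ring⟩
  · rintro ⟨x, y, z, rfl⟩
    simp only [← smul_eq_mul]
    exact add_mem (add_mem (nsmul_mem (AddSubmonoid.subset_closure (by simp)) x)
      (nsmul_mem (AddSubmonoid.subset_closure (by simp)) y))
      (nsmul_mem (AddSubmonoid.subset_closure (by simp)) z)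

/-- Every integer has a representation in the three generators in which the coefficients of `q ^ 3`
and `q ^ 3 + 1` are reduced. -/
theorem exists_reduced_gk_representation {q : ℤ} (hq : 0 < q) (n : ℤ) :
    ∃ x y z : ℤ, 0 ≤ y ∧ y ≤ q ^ 2 - q ∧ 0 ≤ z ∧ z ≤ q - 1 ∧
      n = x * (q ^ 3 - q ^ 2 + q) + y * q ^ 3 + z * (q ^ 3 + 1) := by
  have hm : 0 < q ^ 2 - q + 1 := by nlinarith
  obtain ⟨k, y, hky, hy0, hy⟩ : ∃ k y, -n = (q ^ 2 - q + 1) * k + y ∧ 0 ≤ y ∧ y < q ^ 2 - q + 1 :=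
    ⟨_, _, (Int.mul_ediv_add_emod _ _).symm, Int.emod_nonneg _ hm.ne', Int.emod_lt_of_pos _ hm⟩
  obtain ⟨l, z, hlz, hz0, hz⟩ : ∃ l z, n * (q + 1) + q ^ 3 * k = q * l + z ∧ 0 ≤ z ∧ z < q :=
    ⟨_, _, (Int.mul_ediv_add_emod _ _).symm, Int.emod_nonneg _ hq.ne', Int.emod_lt_of_pos _ hq⟩
  refine ⟨(q + 1) * l - (n * (q + 1) + q ^ 3 * k), y, z, hy0, by omega, hz0, by omega, ?_⟩
  linear_combination q ^ 3 * hky + (q + 1) * (q ^ 2 - q + 1) * hlz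

/-- `q ^ 5 - 2 * q ^ 3 + q ^ 2 - 1` is not a nonnegative combination of the three generators. -/
theorem gk_frobenius_ne {q x y z : ℤ} (hq : 2 ≤ q) (hx : 0 ≤ x) (hy : 0 ≤ y) (hz : 0 ≤ z) :
    q ^ 5 - 2 * q ^ 3 + q ^ 2 - 1 ≠ x * (q ^ 3 - q ^ 2 + q) + y * q ^ 3 + z * (q ^ 3 + 1) := by
  intro h
  have hm : 0 < q ^ 2 - q + 1 := by nlinarith
  have hmy : q ^ 2 - q + 1 ∣ y + 1 := by
    refine ⟨(q + 1) * (y + 1) - (q ^ 3 + q ^ 2 - q - 1 - x * q - z * (q + 1)), ?_⟩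
    linear_combination h
  have hqz : q ∣ z + 1 :=
    ⟨q ^ 4 - 2 * q ^ 2 + q - x * (q ^ 2 - q + 1) - y * q ^ 2 - z * q ^ 2, by linear_combination -h⟩
  have hy' := Int.le_of_dvd (by omega) hmy
  have hz' := Int.le_of_dvd (by omega) hqz
  have h1 : (q ^ 2 - q) * q ^ 3 ≤ y * q ^ 3 :=
    mul_le_mul_of_nonneg_right (by omega) (by positivity)
  have h2 : (q - 1) * (q ^ 3 + 1) ≤ z * (q ^ 3 + 1) :=
    mul_le_mul_of_nonneg_right (by omega) (by positivity)
  have h3 : 0 < q * (q ^ 2 - q + 1) := by positivity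
  have h4 : 0 ≤ x * (q * (q ^ 2 - q + 1)) := by positivity
  linarith

theorem gk_infinite_point_semigroup_gaps
    (q : ℕ) (hq : ∃ p e : ℕ, p.Prime ∧ 1 ≤ e ∧ q = p ^ e) :
    {n : ℕ | n ∉ AddSubmonoid.closure ({q ^ 3 - q ^ 2 + q, q ^ 3, q ^ 3 + 1} : Set ℕ)}.Finite ∧
    {n : ℕ | n ∉ AddSubmonoid.closure ({q ^ 3 - q ^ 2 + q, q ^ 3, q ^ 3 + 1} : Set ℕ)}.ncard
      = (q ^ 3 + 1) * (q ^ 2 - 2) / 2 + 1 := by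
  have hq2 : 2 ≤ q := by
    obtain ⟨p, e, hp, he, rfl⟩ := hq
    exact hp.two_le.trans (Nat.le_self_pow (by omega) p)
  have hqZ : (2 : ℤ) ≤ q := by exact_mod_cast hq2
  have hF : (((q ^ 3 + 1) * (q ^ 2 - 2) + 1 : ℕ) : ℤ) = q ^ 5 - 2 * q ^ 3 + q ^ 2 - 1 := by
    have : 2 ≤ q ^ 2 := by nlinarith
    push_cast [this]
    ring
  have hgen : ((q ^ 3 - q ^ 2 + q : ℕ) : ℤ) = q ^ 3 - q ^ 2 + q := by
    have : q ^ 2 ≤ q ^ 3 := Nat.pow_le_pow_right (by omega) (by omega)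
    push_cast [this]
    ring
  have hmem (n : ℕ) : n ∈ AddSubmonoid.closure ({q ^ 3 - q ^ 2 + q, q ^ 3, q ^ 3 + 1} : Set ℕ) ↔
      ∃ x y z : ℤ, 0 ≤ x ∧ 0 ≤ y ∧ 0 ≤ z ∧
        (n : ℤ) = x * (q ^ 3 - q ^ 2 + q) + y * q ^ 3 + z * (q ^ 3 + 1) := by
    rw [AddSubmonoid.mem_closure_triple_nat]
    constructor
    · rintro ⟨x, y, z, rfl⟩
      refine ⟨x, y, z, by positivity, by positivity, by positivity, ?_⟩
      rw [← hgen]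
      push_cast
      ring
    · rintro ⟨x, y, z, hx, hy, hz, h⟩
      lift x to ℕ using hx
      lift y to ℕ using hy
      lift z to ℕ using hz
      refine ⟨x, y, z, ?_⟩
      rw [← hgen] at h
      exact_mod_cast h
  have hgen0 : (0 : ℤ) ≤ q ^ 3 - q ^ 2 + q := hgen ▸ Int.natCast_nonneg _
  have hor (n : ℕ) (hn : n ∉ AddSubmonoid.closure
      ({q ^ 3 - q ^ 2 + q, q ^ 3, q ^ 3 + 1} : Set ℕ)) :
      ∃ x y z : ℤ, 0 ≤ x ∧ 0 ≤ y ∧ 0 ≤ z ∧ (q ^ 5 - 2 * q ^ 3 + q ^ 2 - 1 - n : ℤ) =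
        x * (q ^ 3 - q ^ 2 + q) + y * q ^ 3 + z * (q ^ 3 + 1) := by
    obtain ⟨x, y, z, hy0, hy, hz0, hz, h⟩ :=
      exists_reduced_gk_representation (q := q) (by omega) n
    have hx : x < 0 := by
      by_contra hx
      exact hn ((hmem n).2 ⟨x, y, z, by omega, hy0, hz0, h⟩)
    exact ⟨-1 - x, q ^ 2 - q - y, q - 1 - z, by omega, by omega, by omega,
      by linear_combination -h⟩
  have key := finite_compl_and_two_mul_ncard_of_symmetric
    (S := AddSubmonoid.closure ({q ^ 3 - q ^ 2 + q, q ^ 3, q ^ 3 + 1} : Set ℕ))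
    (F := (q ^ 3 + 1) * (q ^ 2 - 2) + 1) ?_ ?_
  · simp only [SetLike.mem_coe] at key
    exact ⟨key.1, by omega⟩
  · intro a b hab
    have habZ : (a + b : ℤ) = q ^ 5 - 2 * q ^ 3 + q ^ 2 - 1 := by rw [← hF, ← hab]; push_cast; rfl
    rw [SetLike.mem_coe, SetLike.mem_coe]
    constructor
    · intro ha
      obtain ⟨x, y, z, hx, hy, hz, h⟩ := hor a ha
      exact (hmem b).2 ⟨x, y, z, hx, hy, hz, by linear_combination h + habZ⟩
    · intro hb ha
      obtain ⟨x, y, z, hx, hy, hz, h⟩ := (hmem a).1 ha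
      obtain ⟨x', y', z', hx', hy', hz', h'⟩ := (hmem b).1 hb
      exact gk_frobenius_ne hqZ (add_nonneg hx hx') (add_nonneg hy hy') (add_nonneg hz hz')
        (by linear_combination h + h' - habZ)
  · intro n hn
    by_contra hnS
    obtain ⟨x, y, z, hx, hy, hz, h⟩ := hor n hnS
    have : (0 : ℤ) ≤ x * (q ^ 3 - q ^ 2 + q) + y * q ^ 3 + z * (q ^ 3 + 1) := by positivity
    have hn' : (((q ^ 3 + 1) * (q ^ 2 - 2) + 1 : ℕ) : ℤ) < n := by exact_mod_cast hn
    rw [hF] at hn'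
    linarith
end

section
/- The additive submonoid Δ of ℕ generated by {25, 27, 28, 74, 121} satisfies: (i) the set of natural numbers not belonging to Δ has exactly 99 elements; (ii) every natural number n ≥ 198 belongs to Δ. -/
/-- Coefficients on `27, 28, 74, 121` of the least element of `⟨25, 27, 28, 74, 121⟩` in each residue
class modulo `25`. -/
def gkAperyCoeffs : List (ℕ × ℕ × ℕ × ℕ) :=
  [ (0, 0, 0, 0), (1, 0, 1, 0), (1, 0, 0, 0), (0, 1, 0, 0), (2, 0, 0, 0),
    (1, 1, 0, 0), (0, 2, 0, 0), (2, 1, 0, 0), (1, 2, 0, 0), (0, 3, 0, 0),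
    (2, 2, 0, 0), (1, 3, 0, 0), (0, 4, 0, 0), (2, 3, 0, 0), (1, 4, 0, 0),
    (0, 5, 0, 0), (2, 4, 0, 0), (1, 5, 0, 0), (0, 6, 0, 0), (2, 5, 0, 0),
    (0, 0, 1, 1), (0, 0, 0, 1), (0, 0, 3, 0), (0, 0, 2, 0), (0, 0, 1, 0) ]

/-- The least element of `⟨25, 27, 28, 74, 121⟩` congruent to `r` modulo `25` (for `r < 25`). -/
def gkApery (r : ℕ) : ℕ :=
  let p := gkAperyCoeffs.getD r (0, 0, 0, 0)
  p.1 * 27 + p.2.1 * 28 + p.2.2.1 * 74 + p.2.2.2 * 121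

theorem gkApery_mod : ∀ r < 25, gkApery r % 25 = r := by decide

theorem gkApery_le : ∀ r < 25, gkApery r ≤ 222 := by decide

theorem gkApery_add_le :
    ∀ r < 25, ∀ s < 25, gkApery ((r + s) % 25) ≤ gkApery r + gkApery s := by
  decide +kernel

theorem gkApery_mem (r : ℕ) :
    gkApery r ∈ AddSubmonoid.closure ({25, 27, 28, 74, 121} : Set ℕ) := by
  have mul_mem (k g : ℕ) (hg : g ∈ ({25, 27, 28, 74, 121} : Set ℕ)) :
      k * g ∈ AddSubmonoid.closure ({25, 27, 28, 74, 121} : Set ℕ) := by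
    simpa using nsmul_mem (AddSubmonoid.subset_closure hg) k
  exact add_mem (add_mem (add_mem (mul_mem _ _ (by simp)) (mul_mem _ _ (by simp)))
    (mul_mem _ _ (by simp))) (mul_mem _ _ (by simp))

theorem mem_closure_iff_gkApery_le (n : ℕ) :
    n ∈ AddSubmonoid.closure ({25, 27, 28, 74, 121} : Set ℕ) ↔ gkApery (n % 25) ≤ n := by
  constructor
  · intro h
    induction h using AddSubmonoid.closure_induction with
    | mem x hx =>
      rcases hx with rfl | rfl | rfl | rfl | rfl <;> decide
    | zero => decide
    | add x y _ _ hx hy =>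
      rw [Nat.add_mod]
      exact (gkApery_add_le _ (Nat.mod_lt _ (by simp)) _ (Nat.mod_lt _ (by simp))).trans
        (add_le_add hx hy)
  · intro h
    have hmod := gkApery_mod (n % 25) (Nat.mod_lt _ (by simp))
    obtain ⟨k, hk⟩ : ∃ k, n = gkApery (n % 25) + k * 25 :=
      ⟨(n - gkApery (n % 25)) / 25, by omega⟩
    rw [hk]
    refine add_mem (gkApery_mem _) ?_
    simpa using nsmul_mem (AddSubmonoid.subset_closure
      (show 25 ∈ ({25, 27, 28, 74, 121} : Set ℕ) by simp)) k

theorem mem_closure_of_198_le (n : ℕ) (hn : 198 ≤ n) :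
    n ∈ AddSubmonoid.closure ({25, 27, 28, 74, 121} : Set ℕ) := by
  rw [mem_closure_iff_gkApery_le]
  have hmod := gkApery_mod (n % 25) (Nat.mod_lt _ (by simp))
  have hle := gkApery_le (n % 25) (Nat.mod_lt _ (by simp))
  omega

theorem gk_q3_weierstrass_semigroup :
    {n : ℕ | n ∉ AddSubmonoid.closure ({25, 27, 28, 74, 121} : Set ℕ)}.ncard = 99 ∧
    (∀ n : ℕ, 198 ≤ n → n ∈ AddSubmonoid.closure ({25, 27, 28, 74, 121} : Set ℕ)) := by
  refine ⟨?_, mem_closure_of_198_le⟩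
  have hgaps : {n : ℕ | n ∉ AddSubmonoid.closure ({25, 27, 28, 74, 121} : Set ℕ)} =
      ((Finset.range 198).filter fun n => ¬ gkApery (n % 25) ≤ n : Finset ℕ) := by
    ext n
    have hlarge := mem_closure_of_198_le n
    simp only [mem_closure_iff_gkApery_le] at hlarge
    simp only [Set.mem_ofPred_eq, mem_closure_iff_gkApery_le, Finset.coe_filter, Finset.mem_range]
    grind
  rw [hgaps, Set.ncard_coe_finset]
  decide +kernel
end

section
/- The number of elements of the additive submonoid of ℕ generated by {25, 27, 28, 74} that lie in the interval [0, 197] is exactly 96. -/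
theorem mem_closure_four_iff {a b c d n : ℕ} :
    n ∈ AddSubmonoid.closure ({a, b, c, d} : Set ℕ) ↔
      ∃ x y z w : ℕ, x * a + y * b + z * c + w * d = n := by
  simp only [Set.insert_eq, AddSubmonoid.closure_union, AddSubmonoid.mem_sup,
    AddSubmonoid.mem_closure_singleton, smul_eq_mul]
  constructor
  · rintro ⟨_, ⟨x, rfl⟩, _, ⟨_, ⟨y, rfl⟩, _, ⟨_, ⟨z, rfl⟩, _, ⟨w, rfl⟩, rfl⟩, rfl⟩, rfl⟩
    exact ⟨x, y, z, w, by ring⟩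
  · rintro ⟨x, y, z, w, rfl⟩
    exact ⟨_, ⟨x, rfl⟩, _, ⟨_, ⟨y, rfl⟩, _, ⟨_, ⟨z, rfl⟩, _, ⟨w, rfl⟩, rfl⟩, rfl⟩, by ring⟩

theorem gk_q3_four_gen_count :
    {n : ℕ | n ∈ AddSubmonoid.closure ({25, 27, 28, 74} : Set ℕ) ∧ n ≤ 197}.ncard = 96 := by
  have h : {n : ℕ | n ∈ AddSubmonoid.closure ({25, 27, 28, 74} : Set ℕ) ∧ n ≤ 197} =
      ((Finset.range 198).filter fun n => ∃ w ∈ Finset.range 3, ∃ z ∈ Finset.range 8, ∃ y ∈ Finset.range 8,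
        y * 27 + z * 28 + w * 74 ≤ n ∧ (n - (y * 27 + z * 28 + w * 74)) % 25 = 0 : Finset ℕ) := by
    ext n
    simp only [Set.mem_ofPred_eq, mem_closure_four_iff, Finset.coe_filter, Finset.mem_range]
    constructor
    · rintro ⟨⟨x, y, z, w, rfl⟩, hn⟩
      exact ⟨by omega, w, by omega, z, by omega, y, by omega, by omega, by omega⟩
    · rintro ⟨hn, w, -, z, -, y, -, hle, hmod⟩
      exact ⟨⟨(n - (y * 27 + z * 28 + w * 74)) / 25, y, z, w, by omega⟩, by omega⟩
  rw [h, Set.ncard_coe_finset]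
  decide +kernel
end

section
/- Let p be a prime, e ≥ 1 an integer, q̄ = p^e, and let F be a field of characteristic p. Define h(X) = Σ_{i=0}^{q̄} (−1)^{i+1} X^{i(q̄−1)} ∈ F[X]. If x, y, z ∈ F satisfy z^{q̄²−q̄+1} = y·h(x) and x^{q̄} + x = y^{q̄+1}, then x^{q̄³} + x = y^{q̄³+1} + z^{q̄³+1}; that is, every point of the GK curve lies on the Hermitian surface of degree q̄³ + 1. -/
/-- Telescoping of the alternating geometric sum: `(x ^ q + x) * h(x) = x ^ (q ^ 2) - x`. -/
theorem mul_alternating_sum_eq {F : Type*} [CommRing F] {q : ℕ} (hq : 1 ≤ q)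
    (hneg : ∀ a : F, (-a) ^ q = -a ^ q) (x : F) :
    (x ^ q + x) * ∑ i ∈ Finset.range (q + 1), (-1 : F) ^ (i + 1) * x ^ (i * (q - 1))
      = (x ^ q) ^ q - x := by
  have hx : x ^ q = x ^ (q - 1) * x := by rw [← pow_succ, Nat.sub_add_cancel hq]
  have hsum : ∑ i ∈ Finset.range (q + 1), (-1 : F) ^ (i + 1) * x ^ (i * (q - 1))
      = -∑ i ∈ Finset.range (q + 1), (-x ^ (q - 1)) ^ i := by
    rw [← Finset.sum_neg_distrib]
    refine Finset.sum_congr rfl fun i _ => ?_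
    rw [neg_pow (x ^ (q - 1)), ← pow_mul, mul_comm (q - 1) i]
    ring
  have hgeom := geom_sum_mul (-x ^ (q - 1)) (q + 1)
  rw [pow_succ, hneg] at hgeom
  have hpow : (x ^ q) ^ q = (x ^ (q - 1)) ^ q * (x ^ (q - 1) * x) := by
    conv_lhs => rw [hx, mul_pow, hx]
  rw [hsum, hpow, hx]
  linear_combination x * hgeom

theorem gk_curve_on_hermitian_surface
    (p : ℕ) (hp : p.Prime) (e : ℕ) (he : 1 ≤ e) (q : ℕ) (hq : q = p ^ e)
    (F : Type*) [Field F] [CharP F p] (x y z : F)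
    (h1 : z ^ (q ^ 2 - q + 1)
        = y * ∑ i ∈ Finset.range (q + 1), (-1 : F) ^ (i + 1) * x ^ (i * (q - 1)))
    (h2 : x ^ q + x = y ^ (q + 1)) :
    x ^ (q ^ 3) + x = y ^ (q ^ 3 + 1) + z ^ (q ^ 3 + 1) := by
  have : Fact p.Prime := ⟨hp⟩
  have hq1 : 1 ≤ q := hq ▸ Nat.one_le_pow _ _ hp.pos
  have hadd : ∀ a b : F, (a + b) ^ q = a ^ q + b ^ q := fun a b => by
    rw [hq, add_pow_char_pow]
  have hsub : ∀ a b : F, (a - b) ^ q = a ^ q - b ^ q := fun a b => by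
    rw [hq, sub_pow_char_pow]
  have hneg : ∀ a : F, (-a) ^ q = -a ^ q := fun a => by
    have h := hsub 0 a
    rwa [zero_pow (by omega), zero_sub, zero_sub] at h
  have hH := mul_alternating_sum_eq hq1 hneg x
  set H := ∑ i ∈ Finset.range (q + 1), (-1 : F) ^ (i + 1) * x ^ (i * (q - 1))
  have hfactor : q ^ 3 + 1 = (q ^ 2 - q + 1) * (q + 1) := by
    have hle : q ≤ q ^ 2 := Nat.le_self_pow (by norm_num) q
    zify [hle]
    ring
  have hx3 : x ^ q ^ 3 = ((x ^ q) ^ q) ^ q := by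
    rw [← pow_mul, ← pow_mul]
    congr 1
    ring
  have hz : z ^ (q ^ 3 + 1) = ((x ^ q) ^ q - x) * H ^ q := by
    rw [hfactor, pow_mul, h1, mul_pow, ← h2, ← hH]
    ring
  have hy : y ^ (q ^ 3 + 1) * (x ^ q + x) ^ q = ((x ^ q + x) ^ q) ^ q * (x ^ q + x) := by
    rw [h2]
    simp only [← pow_mul, ← pow_add]
    congr 1
    ring
  have hHq := congrArg (· ^ q) hH
  simp only [mul_pow, hadd, hsub] at hHq
  simp only [hadd] at hy
  rw [hx3]
  by_cases hw : x ^ q + x = 0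
  · have hy0 : y = 0 := by
      rw [hw] at h2
      exact eq_zero_of_pow_eq_zero h2.symm
    have hxq : x ^ q = -x := eq_neg_of_add_eq_zero_left hw
    rw [hz, hy0, zero_pow (by omega)]
    simp only [hxq, hneg, neg_neg]
    ring
  · have hwq : (x ^ q) ^ q + x ^ q ≠ 0 := by
      rw [← hadd]
      exact pow_ne_zero _ hw
    apply mul_right_cancel₀ hwq
    rw [hz]
    linear_combination -hy - ((x ^ q) ^ q - x) * hHq
end

section
/- Let q̄ be a prime power and let F be a finite field with q̄⁶ elements. The number of triples (x, y, z) ∈ F³ satisfying z^{q̄²−q̄+1} = y·h(x) and x^{q̄} + x = y^{q̄+1} equals q̄⁸ − q̄⁶ + q̄⁵. (Together with the single point at infinity, the GK curve has q̄⁶ + 1 + 2g·q̄³ rational points over F_{q̄⁶}, attaining the Hasse–Weil upper bound, where g = (q̄³+1)(q̄²−2)/2 + 1.) -/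
/-- If `R ∘ P` is trivial and the kernels of `P` and `R` have at most `a` and `b` elements in a group
of order `a * b`, then both bounds are attained and the sequence is exact, so that every fiber of `P`
over `ker R` has `a` elements. -/
@[to_additive]
theorem MonoidHom.card_ker_and_card_fiber_of_comp_eq_one {G : Type*} [Group G] [Finite G]
    (P R : G →* G) {a b : ℕ} (ha : 0 < a) (hG : Nat.card G = a * b) (hRP : ∀ x, R (P x) = 1)
    (hP : Nat.card {x // P x = 1} ≤ a) (hR : Nat.card {x // R x = 1} ≤ b) :
    Nat.card {x // R x = 1} = b ∧ ∀ c, R c = 1 → Nat.card {x // P x = c} = a := by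
  change Nat.card P.ker ≤ a at hP
  change Nat.card R.ker ≤ b at hR
  have hle : P.range ≤ R.ker := by
    rintro _ ⟨x, rfl⟩
    exact hRP x
  have hcard : Nat.card P.ker * Nat.card P.range = a * b := by
    rw [← hG, ← Subgroup.card_mul_index P.ker, Subgroup.index_ker]
  have hrange : Nat.card P.range ≤ Nat.card R.ker := Subgroup.card_le_of_le hle
  have hpos : 0 < Nat.card P.range := Nat.card_pos
  have hrb : Nat.card P.range = b := by
    apply le_antisymm (hrange.trans hR)
    by_contra! hlt
    have := Nat.mul_le_mul_right (Nat.card P.range) hP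
    have := Nat.mul_lt_mul_of_pos_left hlt ha
    omega
  have hkb : Nat.card R.ker = b := le_antisymm hR (hrb ▸ hrange)
  have hka : Nat.card P.ker = a := by
    rw [hrb] at hcard hpos
    exact Nat.eq_of_mul_eq_mul_right hpos hcard
  refine ⟨hkb, fun c hc => ?_⟩
  have heq : P.range = R.ker := Subgroup.eq_of_le_of_card_ge hle (by rw [hkb, hrb])
  obtain ⟨x₀, rfl⟩ : c ∈ P.range := heq ▸ hc
  rw [← hka]
  refine Nat.card_congr
    { toFun := fun x => ⟨x₀⁻¹ * x, by simp [MonoidHom.mem_ker, x.2]⟩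
      invFun := fun k => ⟨x₀ * k, by rw [map_mul, P.mem_ker.1 k.2, mul_one]⟩
      left_inv := fun x => by simp
      right_inv := fun k => by simp }

/-- The monic linearized polynomial map `x ↦ x ^ q ^ k + ∑ i < k, c i * x ^ q ^ i`, with `φ` in the
role of the `q`-Frobenius map. -/
def monicLinearized {F : Type*} [Field F] (φ : F →+* F) {k : ℕ} (c : Fin k → F) : F →+ F where
  toFun x := φ^[k] x + ∑ i, c i * φ^[i] x
  map_zero' := by simp
  map_add' x y := by
    simp only [iterate_map_add, mul_add, Finset.sum_add_distrib]
    abel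

theorem iterate_apply_eq_pow {M : Type*} [Monoid M] {φ : M → M} {q : ℕ}
    (hφ : ∀ x, φ x = x ^ q) (i : ℕ) (x : M) : φ^[i] x = x ^ q ^ i := by
  induction i with
  | zero => simp
  | succ i ih => rw [Function.iterate_succ_apply', ih, hφ, ← pow_mul, pow_succ]

open Polynomial in
theorem card_ker_monicLinearized_le {F : Type*} [Field F] [Finite F] {φ : F →+* F} {q : ℕ}
    (hq : 1 < q) (hφ : ∀ x, φ x = x ^ q) {k : ℕ} (c : Fin k → F) :
    Nat.card {x // monicLinearized φ c x = 0} ≤ q ^ k := by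
  classical
  set r : F[X] := ∑ i : Fin k, C (c i) * X ^ q ^ (i : ℕ)
  have hr : r.degree < ((q ^ k : ℕ) : WithBot ℕ) := by
    refine (Polynomial.degree_sum_le _ _).trans_lt ?_
    rw [Finset.sup_lt_iff (WithBot.bot_lt_coe _)]
    intro i _
    refine (Polynomial.degree_C_mul_X_pow_le _ _).trans_lt ?_
    exact_mod_cast Nat.pow_lt_pow_right hq i.2
  have hmonic : (X ^ q ^ k + r).Monic := monic_X_pow_add hr
  have hdeg : (X ^ q ^ k + r).natDegree = q ^ k := by
    rw [natDegree_add_eq_left_of_degree_lt (by rwa [degree_X_pow]), natDegree_X_pow]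
  calc Nat.card {x // monicLinearized φ c x = 0}
      ≤ ((X ^ q ^ k + r).roots.toFinset : Set F).ncard := by
        refine Set.ncard_le_ncard (s := {x | monicLinearized φ c x = 0}) (fun x hx => ?_)
        have hx : φ^[k] x + ∑ i : Fin k, c i * φ^[i] x = 0 := hx
        simp only [iterate_apply_eq_pow hφ] at hx
        simp [hmonic.ne_zero, r, eval_finsetSum, hx]
    _ ≤ (X ^ q ^ k + r).natDegree := by
        rw [Set.ncard_coe_finset]
        exact (Multiset.toFinset_card_le _).trans (card_roots' _)
    _ = q ^ k := hdeg

theorem Nat.card_sigma_const {α : Type*} {β : α → Type*} [Finite α] [∀ a, Finite (β a)] {n : ℕ}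
    (h : ∀ a, Nat.card (β a) = n) : Nat.card (Σ a, β a) = Nat.card α * n := by
  have := Fintype.ofFinite α
  rw [Nat.card_sigma, Finset.sum_congr rfl fun a _ => h a]
  simp

/-- In a finite commutative group of order `m * n` in which `x ^ m = 1` and `x ^ n = 1` have at most
`m` and `n` solutions, each element with `n`-th power one is an `m`-th power in exactly `m` ways. -/
theorem card_pow_eq_of_card_pow_eq_one_le {G : Type*} [CommGroup G] [Finite G] {m n : ℕ}
    (hm : 0 < m) (hG : Nat.card G = m * n)
    (hkm : Nat.card {x : G // x ^ m = 1} ≤ m) (hkn : Nat.card {x : G // x ^ n = 1} ≤ n)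
    {c : G} (hc : c ^ n = 1) : Nat.card {z : G // z ^ m = c} = m := by
  have hcomp (x : G) : powMonoidHom n (powMonoidHom m x) = 1 := by
    rw [powMonoidHom_apply, powMonoidHom_apply, ← pow_mul, ← hG, pow_card_eq_one']
  exact (MonoidHom.card_ker_and_card_fiber_of_comp_eq_one (powMonoidHom m) (powMonoidHom n)
    hm hG hcomp hkm hkn).2 c hc

theorem card_units_pow_eq_one_le {F : Type*} [Field F] {n : ℕ} (hn : 0 < n) :
    Nat.card {x : Fˣ // x ^ n = 1} ≤ n := by
  have : NeZero n := ⟨hn.ne'⟩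
  exact card_rootsOfUnity F n

/-- On the Hermitian curve `x ^ q + x = y ^ (q + 1)`, the right-hand side `y * h x` of the first
equation of the GK curve is `y ^ q ^ 2 - y`. -/
theorem mul_alternating_geom_sum_eq {F : Type*} [Field F] {φ : F →+* F} {q : ℕ} (hq : 1 < q)
    (hφ : ∀ x, φ x = x ^ q) {x y : F} (h : x ^ q + x = y ^ (q + 1)) :
    y * ∑ i ∈ Finset.range (q + 1), (-1 : F) ^ (i + 1) * x ^ (i * (q - 1)) = φ (φ y) - y := by
  rcases eq_or_ne y 0 with rfl | hy
  · simp
  have hx : x ^ q = x ^ (q - 1) * x := by rw [← pow_succ]; congr; omega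
  have hneg : (-1 : F) ^ q = -1 := by rw [← hφ]; simp
  set s := ∑ i ∈ Finset.range (q + 1), (-1 : F) ^ (i + 1) * x ^ (i * (q - 1))
  have hs : s = -∑ i ∈ Finset.range (q + 1), (-(x ^ (q - 1))) ^ i := by
    rw [← Finset.sum_neg_distrib]
    refine Finset.sum_congr rfl fun i _ => ?_
    rw [neg_pow (x ^ (q - 1)), ← pow_mul, mul_comm i]
    ring
  have hgeom : s * (x ^ (q - 1) + 1) = (x ^ (q - 1)) ^ (q + 1) - 1 := by
    have := geom_sum_mul (-(x ^ (q - 1))) (q + 1)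
    rw [neg_pow (x ^ (q - 1)) (q + 1), pow_succ (-1 : F) q, hneg] at this
    rw [hs]
    linear_combination this
  have hsx : s * y ^ (q + 1) = φ (φ x) - x := by
    have : (x ^ (q - 1)) ^ (q + 1) * x = φ (φ x) := by
      rw [hφ, hφ, pow_succ, mul_assoc, ← hx, ← mul_pow, ← hx]
    rw [← h, ← this, hx]
    linear_combination x * hgeom
  have hxy : φ x + x = φ y * y := by rw [hφ, h, hφ, pow_succ]
  have hxy' : φ (φ x) + φ x = φ (φ y) * φ y := by rw [← map_add, hxy, map_mul]
  have hy' : φ y ≠ 0 := by simpa using hy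
  apply mul_right_cancel₀ hy'
  rw [pow_succ, ← hφ] at hsx
  linear_combination hsx + hxy' - hxy

/-- In the field with `q ^ 6` elements, `x ^ q + x = y ^ (q + 1)` has `q` solutions `x` as soon as
`y ^ q ^ 2 - y` is a `(q ^ 2 - q + 1)`-th power. -/
theorem card_hermitian_fiber {F : Type*} [Field F] [Finite F] {φ : F →+* F} {q : ℕ} (hq : 1 < q)
    (hφ : ∀ x, φ x = x ^ q) (hF : Nat.card F = q ^ 6) (hφ6 : ∀ x, φ (φ (φ (φ (φ (φ x))))) = x)
    {y z : F} (h : z ^ (q ^ 2 - q + 1) = φ (φ y) - y) :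
    Nat.card {x // x ^ q + x = y ^ (q + 1)} = q := by
  have key := (AddMonoidHom.card_ker_and_card_fiber_of_comp_eq_zero
    (monicLinearized φ ![1]) (monicLinearized φ ![-1, 1, -1, 1, -1]) (a := q ^ 1) (b := q ^ 5)
    (by positivity) (by rw [hF]; ring)
    (fun x => by simp [monicLinearized, Fin.sum_univ_succ, hφ6]; abel)
    (card_ker_monicLinearized_le hq hφ _) (card_ker_monicLinearized_le hq hφ _)).2
    (y ^ (q + 1)) ?_
  · simpa [monicLinearized, hφ] using key
  have hN : (q ^ 2 - q + 1) * (q + 1) = q ^ 3 + 1 := by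
    have : q ≤ q ^ 2 := Nat.le_self_pow two_ne_zero q
    zify [this]
    ring
  have hpow (u : F) : u ^ (q + 1) = φ u * u := by rw [hφ, pow_succ]
  have hw : φ (φ (φ z)) * z = (φ (φ (φ y)) - φ y) * (φ (φ y) - y) := by
    rw [← map_sub φ, ← hpow, ← h, ← pow_mul, hN, pow_succ, hφ, hφ, hφ, ← pow_mul, ← pow_mul]
    congr 2
    ring
  have hw3 := congrArg (fun u => φ (φ (φ u))) hw
  simp only [map_mul, map_sub, hφ6] at hw3
  rw [hpow]
  simp [monicLinearized, Fin.sum_univ_succ, hφ6]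
  linear_combination hw - hw3

theorem card_subtype_eq_card_units_add_one {F : Type*} [Field F] [Finite F] {p : F → Prop}
    (h0 : p 0) : Nat.card {x // p x} = Nat.card {u : Fˣ // p u} + 1 := by
  have heq : {x | p x} = insert 0 ((↑) '' {u : Fˣ | p u}) := by
    ext x
    rcases eq_or_ne x 0 with rfl | hx
    · simp [h0]
    · simp only [Set.mem_ofPred_eq, Set.mem_insert_iff, hx, false_or, Set.mem_image]
      exact ⟨fun h => ⟨Units.mk0 x hx, h, rfl⟩, by rintro ⟨u, hu, rfl⟩; exact hu⟩
  change {x | p x}.ncard = {u : Fˣ | p u}.ncard + 1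
  rw [heq, Set.ncard_insert_of_notMem (by simp), Set.ncard_image_of_injective _ Units.val_injective]

/-- The trace of `z ^ (q ^ 2 - q + 1)` to the field with `q ^ 2` elements vanishes exactly when the
trace of `(z ^ (q ^ 3 + 1))⁻¹` from the field with `q ^ 3` elements vanishes. -/
theorem trace_pow_eq_zero_iff {F : Type*} [Field F] {φ : F →+* F} {q : ℕ}
    (hφ : ∀ x, φ x = x ^ q) (hφ6 : ∀ x, φ (φ (φ (φ (φ (φ x))))) = x) (z : Fˣ) :
    monicLinearized φ ![1, 0, 1, 0] ((z : F) ^ (q ^ 2 - q + 1)) = 0 ↔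
      monicLinearized φ ![1, 1] (((z ^ (q ^ 3 + 1))⁻¹ : Fˣ) : F) = 0 := by
  have hz : (z : F) ≠ 0 := z.ne_zero
  have hle : q ≤ q ^ 2 := Nat.le_self_pow two_ne_zero q
  have hw : (z : F) ^ (q ^ 2 - q + 1) = φ (φ z) * z * (φ z)⁻¹ := by
    rw [eq_mul_inv_iff_mul_eq₀ (by simp), hφ, hφ, ← pow_mul, ← pow_add, ← pow_succ]
    congr 1
    have := sq q
    omega
  have hd : (((z ^ (q ^ 3 + 1))⁻¹ : Fˣ) : F) = (φ (φ (φ z)) * z)⁻¹ := by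
    rw [Units.val_inv_eq_inv_val, Units.val_pow_eq_pow_val, pow_succ, hφ, hφ, hφ, ← pow_mul,
      ← pow_mul]
    congr 3
    ring
  have key : monicLinearized φ ![1, 0, 1, 0] ((z : F) ^ (q ^ 2 - q + 1)) =
      φ (φ (φ (φ z))) * φ (φ z) * z *
        monicLinearized φ ![1, 1] (((z ^ (q ^ 3 + 1))⁻¹ : Fˣ) : F) := by
    rw [hw, hd]
    simp only [monicLinearized, AddMonoidHom.coe_mk, ZeroHom.coe_mk, Fin.sum_univ_succ]
    simp [hφ6]
    field_simp
    ring
  rw [key]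
  simp [hz]

theorem card_trace_pow_eq_zero {F : Type*} [Field F] [Finite F] {φ : F →+* F} {q : ℕ} (hq : 1 < q)
    (hφ : ∀ x, φ x = x ^ q) (hF : Nat.card F = q ^ 6) (hφ6 : ∀ x, φ (φ (φ (φ (φ (φ x))))) = x) :
    Nat.card {z : F // monicLinearized φ ![1, 0, 1, 0] (z ^ (q ^ 2 - q + 1)) = 0} =
      (q ^ 2 - 1) * (q ^ 3 + 1) + 1 := by
  have hq3 : 1 < q ^ 3 := Nat.one_lt_pow three_ne_zero hq
  have hcardR : Nat.card {d // monicLinearized φ ![1, 1] d = 0} = q ^ 2 :=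
    (AddMonoidHom.card_ker_and_card_fiber_of_comp_eq_zero
      (monicLinearized φ ![-1, 1, 0, -1]) (monicLinearized φ ![1, 1]) (a := q ^ 4) (b := q ^ 2)
      (by positivity) (by rw [hF]; ring)
      (fun x => by simp [monicLinearized, Fin.sum_univ_succ, hφ6]; abel)
      (card_ker_monicLinearized_le hq hφ _) (card_ker_monicLinearized_le hq hφ _)).1
  rw [card_subtype_eq_card_units_add_one (p := fun d => monicLinearized φ ![1, 1] d = 0)
    (map_zero _)] at hcardR
  rw [card_subtype_eq_card_units_add_one
      (p := fun z => monicLinearized φ ![1, 0, 1, 0] (z ^ (q ^ 2 - q + 1)) = 0) (by simp),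
    Nat.add_right_cancel_iff,
    show q ^ 2 - 1 = Nat.card {d : Fˣ // monicLinearized φ ![1, 1] (d : F) = 0} by omega,
    ← Nat.card_sigma_const
      (β := fun d : {d : Fˣ // monicLinearized φ ![1, 1] (d : F) = 0} =>
        {z : Fˣ // z ^ (q ^ 3 + 1) = (d : Fˣ)⁻¹})]
  · exact Nat.card_congr
      { toFun := fun z =>
          ⟨⟨((z : Fˣ) ^ (q ^ 3 + 1))⁻¹, (trace_pow_eq_zero_iff hφ hφ6 _).1 z.2⟩, z, by simp⟩
        invFun := fun s => ⟨s.2, (trace_pow_eq_zero_iff hφ hφ6 _).2 (by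
          rw [s.2.2, inv_inv]; exact s.1.2)⟩
        left_inv := fun _ => rfl
        right_inv := by
          rintro ⟨⟨d, hd⟩, z, hz⟩
          obtain rfl : d = (z ^ (q ^ 3 + 1))⁻¹ := by rw [hz, inv_inv]
          rfl }
  · rintro ⟨d, hd⟩
    have hm : Nat.card {x : Fˣ // x ^ (q ^ 3 + 1) = 1} ≤ q ^ 3 + 1 :=
      card_units_pow_eq_one_le (by omega)
    have hn : Nat.card {x : Fˣ // x ^ (q ^ 3 - 1) = 1} ≤ q ^ 3 - 1 :=
      card_units_pow_eq_one_le (by omega)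
    refine card_pow_eq_of_card_pow_eq_one_le (by omega) ?_ hm hn ?_
    · rw [Nat.card_units, hF, show q ^ 6 = (q ^ 3) ^ 2 by ring, ← Nat.sq_sub_sq, one_pow]
    · have hfix : φ (φ (φ d)) = d := by
        have hd' := congrArg φ hd
        simp [monicLinearized, Fin.sum_univ_succ] at hd hd'
        linear_combination hd' - hd
      have hfix' : d ^ (q ^ 3) = d := by
        ext
        rw [Units.val_pow_eq_pow_val]
        conv_rhs => rw [← hfix, hφ, hφ, hφ, ← pow_mul, ← pow_mul]
        congr 1
        ring
      rw [inv_pow, inv_eq_one, ← mul_eq_right (b := d), ← pow_succ, Nat.sub_add_cancel hq3.le, hfix']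

theorem card_artinSchreier_fiber {F : Type*} [Field F] [Finite F] {φ : F →+* F} {q : ℕ} (hq : 1 < q)
    (hφ : ∀ x, φ x = x ^ q) (hF : Nat.card F = q ^ 6) (hφ6 : ∀ x, φ (φ (φ (φ (φ (φ x))))) = x)
    {w : F} (hw : monicLinearized φ ![1, 0, 1, 0] w = 0) :
    Nat.card {y // w = φ (φ y) - y} = q ^ 2 := by
  have key := (AddMonoidHom.card_ker_and_card_fiber_of_comp_eq_zero
    (monicLinearized φ ![-1, 0]) (monicLinearized φ ![1, 0, 1, 0]) (a := q ^ 2) (b := q ^ 4)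
    (by positivity) (by rw [hF]; ring)
    (fun x => by simp [monicLinearized, Fin.sum_univ_succ, hφ6]; abel)
    (card_ker_monicLinearized_le hq hφ _) (card_ker_monicLinearized_le hq hφ _)).2 w hw
  rw [← key]
  refine Nat.card_congr (Equiv.subtypeEquivRight fun y => ?_)
  simp [monicLinearized, Fin.sum_univ_succ, sub_eq_add_neg, eq_comm]

theorem exists_frobenius_of_card {F : Type*} [Field F] [Finite F] {p e n : ℕ} (hp : p.Prime)
    (hF : Nat.card F = (p ^ e) ^ n) : ∃ φ : F →+* F, ∀ x, φ x = x ^ p ^ e := by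
  have := Fact.mk hp
  have := Fintype.ofFinite F
  have : CharP F p := by
    rw [← pow_mul] at hF
    exact charP_of_card_eq_prime_pow (f := e * n) (by rw [← Nat.card_eq_fintype_card, hF])
  exact ⟨iterateFrobenius F p e, fun x => iterateFrobenius_def p e x⟩

theorem gk_curve_affine_point_count
    (q : ℕ) (hq : ∃ p e : ℕ, p.Prime ∧ 1 ≤ e ∧ q = p ^ e)
    (F : Type*) [Field F] [Fintype F] (hF : Fintype.card F = q ^ 6) :
    {v : F × F × F |
        v.2.2 ^ (q ^ 2 - q + 1)
          = v.2.1 * ∑ i ∈ Finset.range (q + 1), (-1 : F) ^ (i + 1) * v.1 ^ (i * (q - 1)) ∧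
        v.1 ^ q + v.1 = v.2.1 ^ (q + 1)}.ncard
      = q ^ 8 - q ^ 6 + q ^ 5 := by
  obtain ⟨p, e, hp, he, rfl⟩ := hq
  rw [← Nat.card_eq_fintype_card] at hF
  have hq1 : 1 < p ^ e := Nat.one_lt_pow (by omega) hp.one_lt
  obtain ⟨φ, hφ⟩ := exists_frobenius_of_card hp hF
  generalize p ^ e = q at *
  have hφ6 (x : F) : φ (φ (φ (φ (φ (φ x))))) = x :=
    calc φ (φ (φ (φ (φ (φ x))))) = x ^ q ^ 6 := iterate_apply_eq_pow hφ 6 x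
      _ = x := by rw [← hF, Nat.card_eq_fintype_card, FiniteField.pow_card]
  have htrace {y z : F} (h : z ^ (q ^ 2 - q + 1) = φ (φ y) - y) :
      monicLinearized φ ![1, 0, 1, 0] (z ^ (q ^ 2 - q + 1)) = 0 := by
    rw [h]
    simp [monicLinearized, Fin.sum_univ_succ, hφ6]
  have hfiber (t : Σ z : {z : F // monicLinearized φ ![1, 0, 1, 0] (z ^ (q ^ 2 - q + 1)) = 0},
      {y // (z : F) ^ (q ^ 2 - q + 1) = φ (φ y) - y}) :
      Nat.card {x // x ^ q + x = (t.2 : F) ^ (q + 1)} = q :=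
    card_hermitian_fiber hq1 hφ hF hφ6 t.2.2
  rw [← Nat.card_coe_set_eq]
  trans Nat.card (Σ t : Σ z : {z : F // monicLinearized φ ![1, 0, 1, 0] (z ^ (q ^ 2 - q + 1)) = 0},
      {y // (z : F) ^ (q ^ 2 - q + 1) = φ (φ y) - y}, {x // x ^ q + x = (t.2 : F) ^ (q + 1)})
  · refine Nat.card_congr
      { toFun := fun v =>
          have h := v.2.1.trans (mul_alternating_geom_sum_eq hq1 hφ v.2.2)
          ⟨⟨⟨v.1.2.2, htrace h⟩, v.1.2.1, h⟩, v.1.1, v.2.2⟩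
        invFun := fun t => ⟨(t.2, t.1.2, t.1.1),
          t.1.2.2.trans (mul_alternating_geom_sum_eq hq1 hφ t.2.2).symm, t.2.2⟩
        left_inv := fun _ => rfl
        right_inv := fun _ => rfl }
  · rw [Nat.card_sigma_const hfiber,
      Nat.card_sigma_const fun z => card_artinSchreier_fiber hq1 hφ hF hφ6 z.2,
      card_trace_pow_eq_zero hq1 hφ hF hφ6]
    have h2 : 1 ≤ q ^ 2 := Nat.one_le_pow _ _ (by omega)
    have h8 : q ^ 6 ≤ q ^ 8 := Nat.pow_le_pow_right (by omega) (by omega)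
    zify [h2, h8]
    ring
end

section
/- Let q̄ be a prime power and let F be a finite field with q̄⁶ elements. The number of triples (x, y, z) ∈ F³ with z = 0 satisfying z^{q̄²−q̄+1} = y·h(x) and x^{q̄} + x = y^{q̄+1} equals q̄³. -/
open Polynomial in
theorem FiniteField.card_toFinset_roots_of_dvd_X_pow_card_sub_X {F : Type*} [Field F] [Fintype F]
    [DecidableEq F] {P : F[X]} (hP : P ∣ X ^ Fintype.card F - X) :
    P.roots.toFinset.card = P.natDegree := by
  have hne : (X ^ Fintype.card F - X : F[X]) ≠ 0 :=
    FiniteField.X_pow_card_sub_X_ne_zero F Fintype.one_lt_card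
  have hroots := FiniteField.roots_X_pow_card_sub_X F
  have hsplits : (X ^ Fintype.card F - X : F[X]).Splits := by
    rw [splits_iff_card_roots, hroots,
      FiniteField.X_pow_card_sub_X_natDegree_eq F Fintype.one_lt_card]
    rfl
  have hnodup : P.roots.Nodup := by
    refine Multiset.nodup_of_le (Polynomial.roots.le_of_dvd hne hP) ?_
    rw [hroots]
    exact Finset.univ.nodup
  rw [Multiset.toFinset_card_of_nodup hnodup, (hsplits.of_dvd hne hP).natDegree_eq_card_roots]

/-- If `q` is odd or `2 = 0`, as happens in characteristic dividing `q`, the alternating sum `h`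
satisfies `(x ^ q + x) * h x = x ^ (q ^ 2) - x`. -/
theorem pow_add_self_mul_alternating_sum {R : Type*} [CommRing R] {q : ℕ} (hq : 0 < q)
    (hneg : (-1 : R) ^ q = -1) (x : R) :
    (x ^ q + x) * ∑ i ∈ Finset.range (q + 1), (-1 : R) ^ (i + 1) * x ^ (i * (q - 1))
      = x ^ q ^ 2 - x := by
  have hsum : ∑ i ∈ Finset.range (q + 1), (-1 : R) ^ (i + 1) * x ^ (i * (q - 1))
      = -∑ i ∈ Finset.range (q + 1), (-x ^ (q - 1)) ^ i := by
    rw [← Finset.sum_neg_distrib]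
    refine Finset.sum_congr rfl fun i _ => ?_
    rw [neg_pow (x ^ (q - 1)), ← pow_mul, mul_comm (q - 1) i]
    ring
  have hgeom := geom_sum_mul (-x ^ (q - 1)) (q + 1)
  rw [neg_pow (x ^ (q - 1)) (q + 1), pow_succ (-1 : R), hneg, ← pow_mul] at hgeom
  obtain ⟨n, rfl⟩ : ∃ n, q = n + 1 := ⟨q - 1, by omega⟩
  rw [hsum]
  simp only [Nat.add_sub_cancel] at *
  have hexp : x ^ (n + 1) ^ 2 = x * x ^ (n * (n + 1 + 1)) := by ring
  rw [hexp]
  linear_combination x * hgeom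

section Frobenius

variable {R : Type*} [CommRing R] {p : ℕ} [Fact p.Prime] [CharP R p]

open Polynomial in
theorem X_pow_sq_sub_X_dvd (e : ℕ) :
    (X ^ (p ^ e) ^ 2 - X : R[X]) ∣ X ^ (p ^ e) ^ 6 - X := by
  have h1 := sub_pow_char_pow (p := p) (X ^ (p ^ e) ^ 2 : R[X]) X (n := e * 2)
  have h2 := sub_pow_char_pow (p := p) (X ^ (p ^ e) ^ 2 : R[X]) X (n := e * 4)
  rw [pow_mul p e] at h1 h2
  have h : (X ^ (p ^ e) ^ 6 - X : R[X]) = (X ^ (p ^ e) ^ 2 - X) ^ (p ^ e) ^ 4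
      + (X ^ (p ^ e) ^ 2 - X) ^ (p ^ e) ^ 2 + (X ^ (p ^ e) ^ 2 - X) := by
    rw [h1, h2]
    ring
  have hpos : 0 < p ^ e := pow_pos (Fact.out : p.Prime).pos e
  rw [h]
  exact dvd_add (dvd_add (dvd_pow_self _ (by positivity)) (dvd_pow_self _ (by positivity)))
    dvd_rfl

open Polynomial in
theorem X_pow_add_X_sub_C_dvd {e : ℕ} {c : R} (hc : c ^ p ^ e = c) :
    (X ^ p ^ e + X - C c : R[X]) ∣ X ^ (p ^ e) ^ 2 - X := by
  have h1 := sub_pow_char_pow (p := p) (X ^ p ^ e + X : R[X]) (C c) (n := e)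
  rw [add_pow_char_pow, ← C_pow, hc, ← pow_mul, ← sq] at h1
  have h : (X ^ (p ^ e) ^ 2 - X : R[X]) =
      (X ^ p ^ e + X - C c) ^ p ^ e - (X ^ p ^ e + X - C c) := by
    rw [h1]
    ring
  have hpos : 0 < p ^ e := pow_pos (Fact.out : p.Prime).pos e
  rw [h]
  exact dvd_sub (dvd_pow_self _ hpos.ne') dvd_rfl

end Frobenius

section Counting

variable {F : Type*} [Field F] [Fintype F] [DecidableEq F] {p e : ℕ} [Fact p.Prime] [CharP F p]

open Polynomial in
theorem card_filter_pow_sq_eq_self (he : 1 ≤ e) (hF : Fintype.card F = (p ^ e) ^ 6) :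
    (Finset.univ.filter fun y : F => y ^ (p ^ e) ^ 2 = y).card = (p ^ e) ^ 2 := by
  have hlt : 1 < (p ^ e) ^ 2 :=
    Nat.one_lt_pow two_ne_zero (Nat.one_lt_pow (by omega) (Fact.out : p.Prime).one_lt)
  have hcard := FiniteField.card_toFinset_roots_of_dvd_X_pow_card_sub_X
    (P := (X ^ (p ^ e) ^ 2 - X : F[X])) (hF ▸ X_pow_sq_sub_X_dvd e)
  rw [FiniteField.X_pow_card_sub_X_natDegree_eq F hlt] at hcard
  refine Eq.trans (congrArg Finset.card ?_) hcard
  ext y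
  simp [mem_roots (FiniteField.X_pow_card_sub_X_ne_zero F hlt), sub_eq_zero]

open Polynomial in
theorem card_filter_pow_add_self_eq (he : 1 ≤ e) (hF : Fintype.card F = (p ^ e) ^ 6) {c : F}
    (hc : c ^ p ^ e = c) :
    (Finset.univ.filter fun x : F => x ^ p ^ e + x = c).card = p ^ e := by
  have hlt : 1 < p ^ e := Nat.one_lt_pow (by omega) (Fact.out : p.Prime).one_lt
  have hdeg : (X ^ p ^ e + X - C c : F[X]).natDegree = p ^ e := by
    rw [natDegree_sub_C, natDegree_add_eq_left_of_natDegree_lt] <;> simp [hlt]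
  have hne : (X ^ p ^ e + X - C c : F[X]) ≠ 0 := ne_zero_of_natDegree_gt (n := 0) (by omega)
  have hcard := FiniteField.card_toFinset_roots_of_dvd_X_pow_card_sub_X
    (P := (X ^ p ^ e + X - C c : F[X]))
    (hF ▸ (X_pow_add_X_sub_C_dvd hc).trans (X_pow_sq_sub_X_dvd e))
  rw [hdeg] at hcard
  refine Eq.trans (congrArg Finset.card ?_) hcard
  ext x
  simp [mem_roots hne, sub_eq_zero]

end Counting

theorem gk_curve_affine_zero_z_count
    (q : ℕ) (hq : ∃ p e : ℕ, p.Prime ∧ 1 ≤ e ∧ q = p ^ e)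
    (F : Type*) [Field F] [Fintype F] (hF : Fintype.card F = q ^ 6) :
    {v : F × F × F | v.2.2 = 0 ∧
        v.2.2 ^ (q ^ 2 - q + 1)
          = v.2.1 * ∑ i ∈ Finset.range (q + 1), (-1 : F) ^ (i + 1) * v.1 ^ (i * (q - 1)) ∧
        v.1 ^ q + v.1 = v.2.1 ^ (q + 1)}.ncard
      = q ^ 3 := by
  classical
  obtain ⟨p, e, hp, he, rfl⟩ := hq
  have : Fact p.Prime := ⟨hp⟩
  have : CharP F p := charP_of_card_eq_prime_pow (f := e * 6) (by rw [hF, pow_mul])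
  have hpos : 0 < p ^ e := pow_pos hp.pos e
  have hcurve (x y : F) (hxy : x ^ p ^ e + x = y ^ (p ^ e + 1)) :
      y * ∑ i ∈ Finset.range (p ^ e + 1), (-1 : F) ^ (i + 1) * x ^ (i * (p ^ e - 1)) = 0 ↔
        y ^ (p ^ e) ^ 2 = y := by
    have hmul := pow_add_self_mul_alternating_sum hpos (neg_one_pow_expChar_pow F p e) x
    have hfrob : (y ^ (p ^ e + 1)) ^ p ^ e = x ^ (p ^ e) ^ 2 + x ^ p ^ e := by
      rw [← hxy, add_pow_char_pow, ← pow_mul, ← sq]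
    have hfactor : y ^ p ^ e * (y ^ (p ^ e) ^ 2 - y) = x ^ (p ^ e) ^ 2 - x := by
      linear_combination hfrob + hxy
    rw [hxy, pow_succ, mul_assoc, ← hfactor] at hmul
    rcases eq_or_ne y 0 with rfl | hy
    · simp [hp.ne_zero]
    · rw [mul_left_cancel₀ (pow_ne_zero _ hy) hmul, sub_eq_zero]
  let A := (Finset.univ.filter fun y : F => y ^ (p ^ e) ^ 2 = y).sigma fun y =>
    Finset.univ.filter fun x : F => x ^ p ^ e + x = y ^ (p ^ e + 1)
  have hA : A.card = (p ^ e) ^ 3 := by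
    rw [Finset.card_sigma, Finset.sum_congr rfl (g := fun _ => p ^ e),
      Finset.sum_const, card_filter_pow_sq_eq_self he hF, smul_eq_mul, ← pow_succ]
    intro y hy
    apply card_filter_pow_add_self_eq he hF
    have hy' : y ^ (p ^ e) ^ 2 = y := by simpa using hy
    linear_combination y ^ p ^ e * hy'
  have hinj : Function.Injective fun a : (_ : F) × F => (a.2, a.1, (0 : F)) := by
    rintro ⟨y, x⟩ ⟨y', x'⟩ h
    simp_all
  rw [← hA, ← Finset.card_image_of_injective A hinj, ← Set.ncard_coe_finset]
  congr 1
  ext ⟨x, y, z⟩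
  simp only [Set.mem_ofPred_eq, Finset.coe_image, Set.mem_image, Finset.mem_coe, A,
    Finset.mem_sigma, Finset.mem_filter, Finset.mem_univ, true_and, Prod.mk.injEq]
  constructor
  · rintro ⟨rfl, h, hxy⟩
    rw [zero_pow (Nat.succ_ne_zero _)] at h
    exact ⟨⟨y, x⟩, ⟨(hcurve x y hxy).1 h.symm, hxy⟩, rfl, rfl, rfl⟩
  · rintro ⟨⟨y, x⟩, ⟨hy, hxy⟩, rfl, rfl, rfl⟩
    exact ⟨rfl, by rw [zero_pow (Nat.succ_ne_zero _), (hcurve x y hxy).2 hy], hxy⟩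
end

section
/- Let F be a finite field with 64 elements. There exists an F-linear subspace C of F^{224} of dimension 204 such that every nonzero element of C has Hamming weight at least 13; i.e., a linear [224, 204, ≥13]-code over F_{64} exists. -/
/-!
# A linear code with parameters `[224, 204, ≥ 13]` over the field with 64 elements

The Giulietti–Korchmáros curve over `𝔽₆₄` has an affine model

`y² z + x z² + x² y = 0`, `x³ + y³ + x y z + z² + z + 1 = 0`

with a single point at infinity, at which `x`, `y`, `z` and `w = y² + x z` have pole orders
`7`, `8`, `9` and `13`. The code consists of the vectors orthogonal to all functions of pole order
at most `29`, evaluated at the `224` affine rational points, and its minimum distance is bounded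
below by the Feng–Rao order bound. Pole orders are replaced by the weights of monomials in
`x`, `y`, `z`, `w`.
-/

namespace GKCode

/-! ### The weight filtration -/

section Filtration

/-- The pole order at infinity of `x ^ a * y ^ b * z ^ c * w ^ d`. -/
def weight (a b c d : ℕ) : ℕ := 7 * a + 8 * b + 9 * c + 13 * d

variable {F R : Type*} [Field F] [CommRing R] [Algebra F R]

/-- The monomials in `x`, `y`, `z` and `w = y ^ 2 + x * z`. -/
def mono (x y z : R) (a b c d : ℕ) : R := x ^ a * y ^ b * z ^ c * (y ^ 2 + x * z) ^ d

variable (F) in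
/-- The span of the monomials of weight less than `m`. -/
def filtration (x y z : R) (m : ℕ) : Submodule F R :=
  Submodule.span F {f | ∃ a b c d, weight a b c d < m ∧ f = mono x y z a b c d}

theorem mono_mul (x y z : R) (a b c d a' b' c' d' : ℕ) :
    mono x y z a b c d * mono x y z a' b' c' d' =
      mono x y z (a + a') (b + b') (c + c') (d + d') := by
  simp only [mono]; ring

theorem mono_mem_filtration (x y z : R) {a b c d m : ℕ} (h : weight a b c d < m) :
    mono x y z a b c d ∈ filtration F x y z m :=
  Submodule.subset_span ⟨a, b, c, d, h, rfl⟩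

theorem filtration_mono (x y z : R) {m n : ℕ} (h : m ≤ n) :
    filtration F x y z m ≤ filtration F x y z n :=
  Submodule.span_mono fun _ ⟨a, b, c, d, hw, hf⟩ => ⟨a, b, c, d, hw.trans_le h, hf⟩

/-- The exponents of the monomials not divisible by a leading monomial
`y²`, `y w`, `z w`, `w²` or `z³`. -/
def IsNormal (b c d : ℕ) : Prop :=
  b ≤ 1 ∧ c ≤ 2 ∧ d ≤ 1 ∧ (d = 0 ∨ b = 0 ∧ c = 0)

theorem IsNormal.eq_of_weight_eq {a b c d a' b' c' d' : ℕ} (h : IsNormal b c d)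
    (h' : IsNormal b' c' d') (hw : weight a b c d = weight a' b' c' d') :
    a = a' ∧ b = b' ∧ c = c' ∧ d = d' := by
  obtain ⟨hb, hc, hd, -⟩ := id h
  obtain ⟨hb', hc', hd', -⟩ := id h'
  unfold IsNormal at h h'
  unfold weight at hw
  interval_cases b <;> interval_cases c <;> interval_cases d <;>
    first
    | omega
    | interval_cases b' <;> interval_cases c' <;> omega

/-- The equations of the affine curve, over a ring of characteristic two. -/
structure OnCurve (x y z : R) : Prop where
  two : (2 : R) = 0
  left : y ^ 2 * z + x * z ^ 2 + x ^ 2 * y = 0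
  right : x ^ 3 + y ^ 3 + x * y * z + z ^ 2 + z + 1 = 0

variable {x y z : R}

theorem OnCurve.exists_isNormal (h : OnCurve x y z) (a b c d : ℕ) :
    ∃ a' b' c' d', IsNormal b' c' d' ∧ weight a' b' c' d' = weight a b c d ∧
      mono x y z a b c d - mono x y z a' b' c' d' ∈ filtration F x y z (weight a b c d) := by
  obtain ⟨h2, h1, h3⟩ := h
  induction hn : b + c + 2 * d using Nat.strong_induction_on generalizing a b c d with
  | _ n ih =>
  have step : ∀ a₁ b₁ c₁ d₁, b₁ + c₁ + 2 * d₁ < n → weight a₁ b₁ c₁ d₁ = weight a b c d →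
      mono x y z a b c d - mono x y z a₁ b₁ c₁ d₁ ∈ filtration F x y z (weight a b c d) →
      ∃ a' b' c' d', IsNormal b' c' d' ∧ weight a' b' c' d' = weight a b c d ∧
        mono x y z a b c d - mono x y z a' b' c' d' ∈
          filtration F x y z (weight a b c d) := by
    intro a₁ b₁ c₁ d₁ hlt hw hmem
    obtain ⟨a', b', c', d', hN, hw', hm'⟩ := ih _ hlt a₁ b₁ c₁ d₁ rfl
    refine ⟨a', b', c', d', hN, hw'.trans hw, ?_⟩
    rw [hw] at hm'
    simpa using add_mem hmem hm'
  by_cases hN : IsNormal b c d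
  · exact ⟨a, b, c, d, hN, rfl, by simp⟩
  have cases : 2 ≤ b ∨ (1 ≤ b ∧ 1 ≤ d) ∨ (1 ≤ c ∧ 1 ≤ d) ∨ 2 ≤ d ∨ 3 ≤ c := by
    unfold IsNormal at hN; omega
  rcases cases with hb | ⟨hb, hd⟩ | ⟨hc, hd⟩ | hd | hc
  · obtain ⟨b, rfl⟩ := Nat.exists_eq_add_of_le' hb
    refine step (a + 1) b (c + 1) d (by omega) (by simp only [weight]; ring) ?_
    have : mono x y z a (b + 2) c d - mono x y z (a + 1) b (c + 1) d =
        mono x y z a b c (d + 1) := by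
      simp only [mono]
      linear_combination -(x ^ a * y ^ b * z ^ c * (y ^ 2 + x * z) ^ d * (x * z)) * h2
    rw [this]
    exact mono_mem_filtration _ _ _ (by simp only [weight]; omega)
  · obtain ⟨b, rfl⟩ := Nat.exists_eq_add_of_le' hb
    obtain ⟨d, rfl⟩ := Nat.exists_eq_add_of_le' hd
    refine step (a + 3) b c d (by omega) (by simp only [weight]; ring) ?_
    have : mono x y z a (b + 1) c (d + 1) - mono x y z (a + 3) b c d =
        mono x y z a b (c + 2) d + mono x y z a b (c + 1) d + mono x y z a b c d := by
      simp only [mono]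
      linear_combination (x ^ a * y ^ b * z ^ c * (y ^ 2 + x * z) ^ d) *
        (h3 - (x ^ 3 + z ^ 2 + z + 1) * h2)
    rw [this]
    refine add_mem (add_mem ?_ ?_) ?_ <;>
      exact mono_mem_filtration _ _ _ (by simp only [weight]; omega)
  · obtain ⟨c, rfl⟩ := Nat.exists_eq_add_of_le' hc
    obtain ⟨d, rfl⟩ := Nat.exists_eq_add_of_le' hd
    refine step (a + 2) (b + 1) c d (by omega) (by simp only [weight]; ring) ?_
    have : mono x y z a b (c + 1) (d + 1) - mono x y z (a + 2) (b + 1) c d = 0 := by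
      simp only [mono]
      linear_combination (x ^ a * y ^ b * z ^ c * (y ^ 2 + x * z) ^ d) *
        (h1 - (x ^ 2 * y) * h2)
    rw [this]
    exact zero_mem _
  · obtain ⟨d, rfl⟩ := Nat.exists_eq_add_of_le' hd
    refine step a (b + 1) (c + 2) d (by omega) (by simp only [weight]; ring) ?_
    have : mono x y z a b c (d + 2) - mono x y z a (b + 1) (c + 2) d =
        mono x y z a (b + 1) (c + 1) d + mono x y z a (b + 1) c d := by
      simp only [mono]
      linear_combination (x ^ a * y ^ b * z ^ c * (y ^ 2 + x * z) ^ d) *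
        (y * h3 + x * h1 - (y * z ^ 2 + y * z + y + x ^ 3 * y) * h2)
    rw [this]
    refine add_mem ?_ ?_ <;> exact mono_mem_filtration _ _ _ (by simp only [weight]; omega)
  · obtain ⟨c, rfl⟩ := Nat.exists_eq_add_of_le' hc
    refine step (a + 2) b c (d + 1) (by omega) (by simp only [weight]; ring) ?_
    have : mono x y z a b (c + 3) d - mono x y z (a + 2) b c (d + 1) =
        mono x y z a b (c + 2) d + mono x y z a b (c + 1) d := by
      simp only [mono]
      linear_combination (x ^ a * y ^ b * z ^ c * (y ^ 2 + x * z) ^ d) *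
        (z * h3 - y * h1 - (x ^ 3 * z + z ^ 2 + z) * h2)
    rw [this]
    refine add_mem ?_ ?_ <;> exact mono_mem_filtration _ _ _ (by simp only [weight]; omega)

/-- Two monomials of the same weight agree up to terms of lower weight. -/
theorem OnCurve.mono_sub_mono_mem (h : OnCurve x y z) {a b c d a' b' c' d' : ℕ}
    (hw : weight a b c d = weight a' b' c' d') :
    mono x y z a b c d - mono x y z a' b' c' d' ∈ filtration F x y z (weight a b c d) := by
  obtain ⟨a₁, b₁, c₁, d₁, hN₁, hw₁, hm₁⟩ := h.exists_isNormal (F := F) a b c d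
  obtain ⟨a₂, b₂, c₂, d₂, hN₂, hw₂, hm₂⟩ := h.exists_isNormal (F := F) a' b' c' d'
  obtain ⟨rfl, rfl, rfl, rfl⟩ : a₁ = a₂ ∧ b₁ = b₂ ∧ c₁ = c₂ ∧ d₁ = d₂ := by
    exact hN₁.eq_of_weight_eq hN₂ (hw₁.trans (hw.trans hw₂.symm))
  rw [← hw] at hm₂
  simpa using sub_mem hm₁ hm₂

/-- Membership in the Weierstrass semigroup generated by `7`, `8`, `9` and `13`. -/
def IsPoleNumber (n : ℕ) : Prop :=
  n = 0 ∨ (7 ≤ n ∧ n ≤ 9) ∨ (13 ≤ n ∧ n ≠ 19)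

instance : DecidablePred IsPoleNumber := fun n => by unfold IsPoleNumber; infer_instance

theorem isPoleNumber_weight (a b c d : ℕ) : IsPoleNumber (weight a b c d) := by
  unfold IsPoleNumber weight
  by_contra h
  have ha : a < 3 := by omega
  have hb : b < 3 := by omega
  have hc : c < 3 := by omega
  interval_cases a <;> interval_cases b <;> interval_cases c <;> omega

theorem IsPoleNumber.exists_weight_eq {n : ℕ} (hn : IsPoleNumber n) :
    ∃ a b c d, weight a b c d = n := by
  unfold IsPoleNumber at hn
  obtain h | h | h | h | h | h | h | h : n = 13 ∨ n % 7 = 0 ∨ n % 7 = 1 ∧ 8 ≤ n ∨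
      n % 7 = 2 ∧ 9 ≤ n ∨ n % 7 = 3 ∧ 17 ≤ n ∨ n % 7 = 4 ∧ 18 ≤ n ∨ n % 7 = 5 ∧ 26 ≤ n ∨
      n % 7 = 6 ∧ 13 ≤ n := by omega
  · exact ⟨0, 0, 0, 1, by simp only [weight]; omega⟩
  · exact ⟨n / 7, 0, 0, 0, by simp only [weight]; omega⟩
  · exact ⟨(n - 8) / 7, 1, 0, 0, by simp only [weight]; omega⟩
  · exact ⟨(n - 9) / 7, 0, 1, 0, by simp only [weight]; omega⟩
  · exact ⟨(n - 17) / 7, 1, 1, 0, by simp only [weight]; omega⟩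
  · exact ⟨(n - 18) / 7, 0, 2, 0, by simp only [weight]; omega⟩
  · exact ⟨(n - 26) / 7, 0, 0, 2, by simp only [weight]; omega⟩
  · exact ⟨(n - 13) / 7, 0, 0, 1, by simp only [weight]; omega⟩

theorem OnCurve.exists_filtration_succ_le (h : OnCurve x y z) (m : ℕ) :
    ∃ e : R, filtration F x y z (m + 1) ≤ filtration F x y z m ⊔ Submodule.span F {e} := by
  by_cases hm : ∃ a b c d, weight a b c d = m
  · obtain ⟨a, b, c, d, rfl⟩ := hm
    refine ⟨mono x y z a b c d, Submodule.span_le.2 ?_⟩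
    rintro _ ⟨a', b', c', d', hw, rfl⟩
    rcases Nat.lt_succ_iff_lt_or_eq.1 hw with hw | hw
    · exact Submodule.mem_sup_left (mono_mem_filtration _ _ _ hw)
    · have := h.mono_sub_mono_mem (F := F) hw
      rw [hw] at this
      exact Submodule.mem_sup.2 ⟨_, this, _, Submodule.mem_span_singleton_self _, by simp⟩
  · refine ⟨0, le_sup_of_le_left (Submodule.span_le.2 ?_)⟩
    rintro _ ⟨a, b, c, d, hw, rfl⟩
    exact mono_mem_filtration _ _ _
      ((Nat.lt_succ_iff.1 hw).lt_of_ne fun h' => hm ⟨a, b, c, d, h'⟩)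

theorem filtration_succ_eq_of_not_isPoleNumber (x y z : R) {m : ℕ} (hm : ¬ IsPoleNumber m) :
    filtration F x y z (m + 1) = filtration F x y z m := by
  refine le_antisymm (Submodule.span_le.2 ?_) (filtration_mono _ _ _ m.le_succ)
  rintro _ ⟨a, b, c, d, hw, rfl⟩
  exact mono_mem_filtration _ _ _
    ((Nat.lt_succ_iff.1 hw).lt_of_ne fun h' => hm (h' ▸ isPoleNumber_weight a b c d))

theorem OnCurve.finrank_filtration_le [Module.Finite F R] (h : OnCurve x y z) (m : ℕ) :
    Module.finrank F (filtration F x y z m) ≤ ((Finset.range m).filter IsPoleNumber).card := by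
  induction m with
  | zero =>
    have : filtration F x y z 0 = ⊥ := by
      rw [filtration, Submodule.span_eq_bot]
      rintro _ ⟨a, b, c, d, hw, rfl⟩
      omega
    simp [this]
  | succ m ih =>
    rw [Finset.range_add_one, Finset.filter_insert]
    split_ifs with hm
    · obtain ⟨e, he⟩ := h.exists_filtration_succ_le (F := F) m
      rw [Finset.card_insert_of_notMem (by simp)]
      calc Module.finrank F (filtration F x y z (m + 1))
          ≤ Module.finrank F ↥(filtration F x y z m ⊔ Submodule.span F {e}) :=
            Submodule.finrank_mono he
        _ ≤ Module.finrank F (filtration F x y z m) + Module.finrank F (Submodule.span F {e}) :=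
            Submodule.finrank_add_le_finrank_add_finrank _ _
        _ ≤ _ := Nat.add_le_add ih (by simpa using finrank_span_le_card (R := F) ({e} : Set R))
    · rwa [filtration_succ_eq_of_not_isPoleNumber x y z hm]

end Filtration

/-! ### The order bound -/

section OrderBound

variable {F ι : Type*} [Field F] [Fintype ι]

/-- A vector whose associated bilinear form is triangular with nonzero diagonal on families
indexed by `T` has Hamming weight at least the size of `T`. -/
theorem card_le_hammingNorm_of_triangular [DecidableEq F] {κ : Type*} [LinearOrder κ]
    (v : ι → F) (T : Finset κ) (f g : κ → ι → F)
    (diag : ∀ s ∈ T, v ⬝ᵥ (f s * g s) ≠ 0)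
    (lower : ∀ s ∈ T, ∀ t ∈ T, s < t → v ⬝ᵥ (f s * g t) = 0) :
    T.card ≤ hammingNorm v := by
  classical
  let A : Matrix T ι F := Matrix.of fun s i => f s i
  let B : Matrix ι T F := Matrix.of fun i s => g s i
  have entry : ∀ s t : T, (A * Matrix.diagonal v * B) s t = v ⬝ᵥ (f s * g t) := by
    intro s t
    rw [Matrix.mul_apply]
    simp only [Matrix.mul_diagonal, dotProduct, A, B, Matrix.of_apply, Pi.mul_apply]
    exact Finset.sum_congr rfl fun i _ => by ring
  have hdet : (A * Matrix.diagonal v * B).det ≠ 0 := by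
    rw [Matrix.det_of_isLowerTriangular]
    · exact Finset.prod_ne_zero_iff.2 fun s _ => by rw [entry]; exact diag s s.2
    · intro s t hst
      rw [entry]
      exact lower s s.2 t t.2 hst
  calc T.card = (A * Matrix.diagonal v * B).rank := by
        rw [Matrix.rank_of_isUnit _ ((Matrix.isUnit_iff_isUnit_det _).2 hdet.isUnit),
          Fintype.card_coe]
    _ ≤ (A * Matrix.diagonal v).rank := Matrix.rank_mul_le_left _ _
    _ ≤ (Matrix.diagonal v).rank := Matrix.rank_mul_le_right _ _
    _ = hammingNorm v := by
        rw [Matrix.rank_diagonal, Fintype.card_subtype, hammingNorm]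

/-- The decompositions of `m` as a sum of two pole numbers. -/
def splittings (m : ℕ) : Finset ℕ :=
  (Finset.range (m + 1)).filter fun s => IsPoleNumber s ∧ IsPoleNumber (m - s)

theorem thirteen_le_card_splittings {m : ℕ} (hm : 30 ≤ m) : 13 ≤ (splittings m).card := by
  rcases lt_or_ge m 42 with h | h
  · interval_cases m <;> decide +kernel
  · have hsub : ({0, 7, 8, 9, 13, 14, 15, 16, 17, 18, 20, 21, 22} : Finset ℕ) ⊆
        splittings m := by
      intro s hs
      simp only [Finset.mem_insert, Finset.mem_singleton] at hs
      rw [splittings, Finset.mem_filter, Finset.mem_range]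
      unfold IsPoleNumber
      omega
    exact (by decide : 13 = _).le.trans (Finset.card_le_card hsub)

/-- Over a finite field, the monomials in coordinates separating the points of a finite set
have no common nonzero orthogonal vector. -/
theorem exists_dotProduct_mono_ne_zero [Finite F] {x y z : ι → F}
    (hinj : Function.Injective fun i => (x i, y i, z i)) {v : ι → F} (hv : v ≠ 0) :
    ∃ a b c d, v ⬝ᵥ mono x y z a b c d ≠ 0 := by
  classical
  have := Fintype.ofFinite F
  by_contra! hall
  have hadj : ∀ f ∈ Algebra.adjoin F {x, y, z}, v ⬝ᵥ f = 0 := by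
    intro f hf
    rw [← Subalgebra.mem_toSubmodule, Algebra.adjoin_eq_span] at hf
    induction hf using Submodule.span_induction with
    | mem f hf =>
      obtain ⟨a, b, c, d, rfl⟩ : ∃ a b c d, f = mono x y z a b c d := by
        induction hf using Submonoid.closure_induction with
        | mem f hf =>
          rcases hf with rfl | rfl | rfl
          · exact ⟨1, 0, 0, 0, by simp [mono]⟩
          · exact ⟨0, 1, 0, 0, by simp [mono]⟩
          · exact ⟨0, 0, 1, 0, by simp [mono]⟩
        | one => exact ⟨0, 0, 0, 0, by simp [mono]⟩
        | mul f g _ _ hf hg =>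
          obtain ⟨a, b, c, d, rfl⟩ := hf
          obtain ⟨a', b', c', d', rfl⟩ := hg
          exact ⟨_, _, _, _, mono_mul ..⟩
      exact hall a b c d
    | zero => simp
    | add f g _ _ hf hg => rw [dotProduct_add, hf, hg, add_zero]
    | smul r f _ hf => rw [dotProduct_smul, hf, smul_zero]
  obtain ⟨i, hi⟩ := Function.ne_iff.1 hv
  let ind (u : ι → F) : ι → F := 1 - (u - algebraMap F (ι → F) (u i)) ^ (Fintype.card F - 1)
  have ind_mem : ∀ u ∈ Algebra.adjoin F {x, y, z}, ind u ∈ Algebra.adjoin F {x, y, z} :=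
    fun u hu => sub_mem (one_mem _) (pow_mem (sub_mem hu (Subalgebra.algebraMap_mem _ _)) _)
  have ind_self : ∀ u, ind u i = 1 := fun u => by
    have : Fintype.card F - 1 ≠ 0 := Nat.sub_ne_zero_of_lt Fintype.one_lt_card
    simp [ind, this]
  have ind_ne : ∀ u j, u j ≠ u i → ind u j = 0 := fun u j h => by
    simp [ind, FiniteField.pow_card_sub_one_eq_one _ (sub_ne_zero.2 h)]
  have key := hadj (ind x * ind y * ind z) (mul_mem (mul_mem
    (ind_mem x (Algebra.subset_adjoin (by simp))) (ind_mem y (Algebra.subset_adjoin (by simp))))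
    (ind_mem z (Algebra.subset_adjoin (by simp))))
  rw [dotProduct, Finset.sum_eq_single i] at key
  · exact hi (by simpa [ind_self] using key)
  · intro j _ hj
    have : x j ≠ x i ∨ y j ≠ y i ∨ z j ≠ z i := by
      by_contra! h
      exact hj (hinj (by simp [h]))
    rcases this with h | h | h <;> simp [ind_ne _ _ h]
  · simp

theorem OnCurve.thirteen_le_hammingNorm [Finite F] [DecidableEq F] {x y z : ι → F}
    (h : OnCurve x y z) (hinj : Function.Injective fun i => (x i, y i, z i)) {v : ι → F}
    (hv : v ≠ 0) (horth : ∀ f ∈ filtration F x y z 30, v ⬝ᵥ f = 0) :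
    13 ≤ hammingNorm v := by
  classical
  have hex : ∃ m a b c d, weight a b c d = m ∧ v ⬝ᵥ mono x y z a b c d ≠ 0 := by
    obtain ⟨a, b, c, d, hne⟩ := exists_dotProduct_mono_ne_zero hinj hv
    exact ⟨_, a, b, c, d, rfl, hne⟩
  obtain ⟨a, b, c, d, hw, hne⟩ := Nat.find_spec hex
  have hmin : ∀ a' b' c' d', weight a' b' c' d' < Nat.find hex →
      v ⬝ᵥ mono x y z a' b' c' d' = 0 := fun a' b' c' d' hlt => by
    by_contra hne'
    exact Nat.find_min hex hlt ⟨a', b', c', d', rfl, hne'⟩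
  generalize Nat.find hex = m at hw hmin
  have hker : ∀ f ∈ filtration F x y z m, v ⬝ᵥ f = 0 := by
    intro f hf
    induction hf using Submodule.span_induction with
    | mem f hf =>
      obtain ⟨a', b', c', d', hlt, rfl⟩ := hf
      exact hmin _ _ _ _ hlt
    | zero => simp
    | add f g _ _ hf hg => rw [dotProduct_add, hf, hg, add_zero]
    | smul r f _ hf => rw [dotProduct_smul, hf, smul_zero]
  have hm : 30 ≤ m := by
    by_contra! hlt
    exact hne (horth _ (mono_mem_filtration _ _ _ (hw.trans_lt hlt)))
  have hrep : ∀ n, ∃ f : ι → F, IsPoleNumber n →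
      ∃ a b c d, weight a b c d = n ∧ f = mono x y z a b c d := fun n => by
    by_cases hn : IsPoleNumber n
    · obtain ⟨a, b, c, d, hw⟩ := hn.exists_weight_eq
      exact ⟨_, fun _ => ⟨a, b, c, d, hw, rfl⟩⟩
    · exact ⟨0, fun h => absurd h hn⟩
  choose e he using hrep
  refine (thirteen_le_card_splittings hm).trans
    (card_le_hammingNorm_of_triangular v (splittings m) e (fun s => e (m - s)) ?_ ?_)
  · intro s hs
    simp only [splittings, Finset.mem_filter, Finset.mem_range] at hs
    obtain ⟨a₁, b₁, c₁, d₁, hw₁, he₁⟩ := he s hs.2.1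
    obtain ⟨a₂, b₂, c₂, d₂, hw₂, he₂⟩ := he (m - s) hs.2.2
    have hsum : weight a b c d = weight (a₁ + a₂) (b₁ + b₂) (c₁ + c₂) (d₁ + d₂) := by
      simp only [weight] at hw hw₁ hw₂ ⊢; omega
    have := hker _ (hw ▸ h.mono_sub_mono_mem (F := F) hsum)
    rw [dotProduct_sub, sub_eq_zero] at this
    simp only [he₁, he₂, mono_mul]
    rwa [← this]
  · intro s hs t ht hst
    simp only [splittings, Finset.mem_filter, Finset.mem_range] at hs ht
    obtain ⟨a₁, b₁, c₁, d₁, hw₁, he₁⟩ := he s hs.2.1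
    obtain ⟨a₂, b₂, c₂, d₂, hw₂, he₂⟩ := he (m - t) ht.2.2
    simp only [he₁, he₂, mono_mul]
    exact hmin _ _ _ _ (by simp only [weight] at hw₁ hw₂ ⊢; omega)

theorem OnCurve.exists_code [Finite F] [DecidableEq F] {x y z : ι → F}
    (h : OnCurve x y z) (hinj : Function.Injective fun i => (x i, y i, z i)) :
    ∃ C : Submodule F (ι → F), Module.finrank F C = Fintype.card ι - 20 ∧
      ∀ v ∈ C, v ≠ 0 → 13 ≤ hammingNorm v := by
  classical
  let φ : (ι → F) →ₗ[F] Module.Dual F (filtration F x y z 30) :=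
    (LinearMap.lcomp F F (filtration F x y z 30).subtype).comp (dotProductBilin F F)
  have hker : Fintype.card ι - 20 ≤ Module.finrank F (LinearMap.ker φ) := by
    have hnull := φ.finrank_range_add_finrank_ker
    rw [Module.finrank_fintype_fun_eq_card] at hnull
    have hrange : Module.finrank F (LinearMap.range φ) ≤ 20 :=
      calc Module.finrank F (LinearMap.range φ)
          ≤ Module.finrank F (Module.Dual F (filtration F x y z 30)) := Submodule.finrank_le _
        _ = Module.finrank F (filtration F x y z 30) := Subspace.dual_finrank_eq
        _ ≤ 20 := h.finrank_filtration_le 30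
    omega
  obtain ⟨b, hb⟩ := exists_linearIndependent_of_le_finrank hker
  refine ⟨(Submodule.span F (Set.range b)).map (LinearMap.ker φ).subtype, ?_, ?_⟩
  · rw [Submodule.finrank_map_subtype_eq,
      finrank_span_eq_card hb, Fintype.card_fin]
  · rintro _ ⟨v, -, rfl⟩ hv
    refine h.thirteen_le_hammingNorm hinj hv fun f hf => ?_
    exact LinearMap.congr_fun (LinearMap.mem_ker.1 v.2) ⟨f, hf⟩

end OrderBound

/-! ### Rational points -/

section RationalPoints

/-- Elements of `𝔽₈ = 𝔽₂(β)`, where `β³ = β + 1`, in coordinates with respect to `1, β, β²`. -/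
abbrev Oct : Type := Bool × Bool × Bool

/-- Elements of `𝔽₆₄ = 𝔽₈(ω)`, where `ω² = ω + 1`, in coordinates with respect to `1, ω`. -/
abbrev Sext : Type := Oct × Oct

instance : DecidableEq Oct := instDecidableEqProd

instance : Fintype Oct := instFintypeProd _ _

def Oct.sum : Oct → Oct → Oct
  | (a, b, c), (a', b', c') => (a ^^ a', b ^^ b', c ^^ c')

def Oct.prod : Oct → Oct → Oct
  | (a, b, c), (a', b', c') =>
    let p₃ := (b && c') ^^ (c && b')
    let p₄ := c && c'
    ((a && a') ^^ p₃, ((a && b') ^^ (b && a')) ^^ (p₃ ^^ p₄),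
      ((a && c') ^^ ((b && b') ^^ (c && a'))) ^^ p₄)

def Sext.sum : Sext → Sext → Sext
  | (a, b), (a', b') => (a.sum a', b.sum b')

def Sext.prod : Sext → Sext → Sext
  | (a, b), (a', b') =>
    let q := b.prod b'
    ((a.prod a').sum q, ((a.prod b').sum (b.prod a')).sum q)

/-- The element whose coordinates are the binary digits of a number less than `64`. -/
def Sext.ofNat (n : ℕ) : Sext :=
  ((n.testBit 0, n.testBit 1, n.testBit 2), (n.testBit 3, n.testBit 4, n.testBit 5))

variable {F : Type*} [Field F]

def bit (a : Bool) : F := if a then 1 else 0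

def Oct.eval (β : F) : Oct → F
  | (a, b, c) => bit a + bit b * β + bit c * β ^ 2

def Sext.eval (β ω : F) : Sext → F
  | (a, b) => a.eval β + b.eval β * ω

theorem bit_xor (h2 : (2 : F) = 0) (a b : Bool) : (bit (a ^^ b) : F) = bit a + bit b := by
  cases a <;> cases b <;> simp [bit]
  linear_combination -h2

theorem bit_and (a b : Bool) : (bit (a && b) : F) = bit a * bit b := by
  cases a <;> cases b <;> simp [bit]

theorem Oct.eval_sum (h2 : (2 : F) = 0) (β : F) (a b : Oct) :
    (a.sum b).eval β = a.eval β + b.eval β := by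
  simp only [Oct.sum, Oct.eval, bit_xor h2]; ring

theorem Oct.eval_prod (h2 : (2 : F) = 0) {β : F} (hβ : β ^ 3 = β + 1) (a b : Oct) :
    (a.prod b).eval β = a.eval β * b.eval β := by
  obtain ⟨a₀, a₁, a₂⟩ := a
  obtain ⟨b₀, b₁, b₂⟩ := b
  simp only [Oct.prod, Oct.eval, bit_xor h2, bit_and]
  linear_combination -(bit a₁ * bit b₂ + bit a₂ * bit b₁ + bit a₂ * bit b₂ * β : F) * hβ

theorem Sext.eval_sum (h2 : (2 : F) = 0) (β ω : F) (a b : Sext) :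
    (a.sum b).eval β ω = a.eval β ω + b.eval β ω := by
  simp only [Sext.sum, Sext.eval, Oct.eval_sum h2]; ring

theorem Sext.eval_prod (h2 : (2 : F) = 0) {β ω : F} (hβ : β ^ 3 = β + 1)
    (hω : ω ^ 2 = ω + 1) (a b : Sext) :
    (a.prod b).eval β ω = a.eval β ω * b.eval β ω := by
  obtain ⟨a₀, a₁⟩ := a
  obtain ⟨b₀, b₁⟩ := b
  simp only [Sext.prod, Sext.eval, Oct.eval_sum h2, Oct.eval_prod h2 hβ]
  linear_combination -(a₁.eval β * b₁.eval β) * hω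

theorem Sext.eval_ofNat_zero (β ω : F) : (Sext.ofNat 0).eval β ω = 0 := by
  simp [Sext.ofNat, Sext.eval, Oct.eval, bit]

theorem Sext.eval_ofNat_one (β ω : F) : (Sext.ofNat 1).eval β ω = 1 := by
  simp [Sext.ofNat, Sext.eval, Oct.eval, bit, Nat.testBit]

theorem Sext.exists_prod_eq_one :
    ∀ a : Sext, a ≠ Sext.ofNat 0 → ∃ b, a.prod b = Sext.ofNat 1 := by
  decide +kernel

theorem Sext.eq_of_sum_eq_zero :
    ∀ a b : Sext, a.sum b = Sext.ofNat 0 → a = b := by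
  decide +kernel

theorem Sext.ofNat_injOn : Set.InjOn Sext.ofNat (Set.Iio 64) := by
  have : ∀ m < 64, ∀ n < 64, Sext.ofNat m = Sext.ofNat n → m = n := by decide +kernel
  exact fun m hm n hn => this m hm n hn

theorem Sext.eval_injective (h2 : (2 : F) = 0) {β ω : F} (hβ : β ^ 3 = β + 1)
    (hω : ω ^ 2 = ω + 1) : Function.Injective (Sext.eval β ω) := by
  intro a b hab
  by_contra hne
  obtain ⟨c, hc⟩ := Sext.exists_prod_eq_one _ (mt (Sext.eq_of_sum_eq_zero a b) hne)
  have := congrArg (Sext.eval β ω) hc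
  rw [Sext.eval_prod h2 hβ hω, Sext.eval_sum h2, hab, Sext.eval_ofNat_one] at this
  exact one_ne_zero (by linear_combination -this + b.eval β ω * c.eval β ω * h2 : (1 : F) = 0)

/-- The coordinates of the affine rational points, encoded as numbers less than `64`. -/
def points : List (ℕ × ℕ × ℕ) :=
  [(0, 0, 8), (0, 0, 9), (0, 1, 0), (0, 8, 0), (0, 9, 0), (1, 0, 0), (1, 21, 18), (1, 23, 16),
    (1, 35, 32), (1, 39, 36), (1, 51, 54), (1, 53, 48), (2, 3, 1), (2, 3, 6), (2, 40, 20),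
    (2, 45, 22), (2, 51, 24), (2, 53, 27), (3, 58, 51), (3, 61, 53), (4, 5, 1), (4, 5, 2),
    (4, 21, 40), (4, 23, 45), (4, 56, 38), (4, 63, 34), (5, 28, 21), (5, 31, 23), (6, 7, 1),
    (6, 7, 4), (6, 24, 50), (6, 27, 52), (6, 35, 63), (6, 39, 56), (7, 43, 35), (7, 46, 39),
    (8, 0, 0), (8, 29, 54), (8, 31, 32), (8, 43, 48), (8, 47, 18), (8, 59, 36), (8, 61, 16),
    (9, 0, 0), (9, 28, 36), (9, 30, 48), (9, 42, 16), (9, 46, 54), (9, 58, 18), (9, 60, 32),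
    (10, 9, 63), (10, 19, 10), (10, 20, 61), (10, 61, 33), (11, 8, 56), (11, 17, 11), (11, 22, 58),
    (11, 58, 37), (12, 9, 27), (12, 31, 49), (12, 37, 12), (12, 38, 31), (13, 8, 24), (13, 28, 55),
    (13, 33, 13), (13, 34, 28), (14, 9, 45), (14, 43, 17), (14, 50, 43), (14, 55, 14), (15, 8, 40),
    (15, 46, 19), (15, 49, 15), (15, 52, 46), (16, 5, 20), (16, 27, 1), (16, 27, 6), (16, 29, 24),
    (16, 40, 22), (16, 43, 27), (17, 1, 56), (17, 11, 11), (17, 21, 37), (17, 52, 58), (18, 5, 22),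
    (18, 24, 1), (18, 24, 6), (18, 30, 27), (18, 45, 20), (18, 46, 24), (19, 1, 63), (19, 10, 10),
    (19, 23, 33), (19, 50, 61), (20, 14, 44), (20, 19, 62), (20, 41, 26), (21, 40, 39),
    (21, 45, 36), (22, 15, 41), (22, 17, 57), (22, 44, 25), (23, 40, 32), (23, 45, 35),
    (24, 21, 51), (24, 42, 53), (25, 8, 63), (25, 25, 10), (25, 38, 61), (25, 42, 33), (26, 9, 56),
    (26, 26, 11), (26, 34, 58), (26, 47, 37), (27, 23, 53), (27, 47, 51), (28, 7, 51),
    (28, 56, 54), (29, 3, 18), (29, 27, 21), (30, 3, 16), (30, 24, 23), (31, 7, 53), (31, 63, 48),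
    (32, 7, 38), (32, 45, 1), (32, 45, 2), (32, 47, 40), (32, 56, 34), (32, 61, 45), (33, 1, 24),
    (33, 13, 13), (33, 22, 28), (33, 39, 55), (34, 11, 57), (34, 33, 25), (34, 62, 41),
    (35, 56, 48), (35, 63, 53), (36, 7, 34), (36, 40, 1), (36, 40, 2), (36, 42, 45), (36, 58, 40),
    (36, 63, 38), (37, 1, 27), (37, 12, 12), (37, 20, 31), (37, 35, 49), (38, 10, 62),
    (38, 37, 26), (38, 57, 44), (39, 56, 51), (39, 63, 54), (40, 39, 21), (40, 60, 23),
    (41, 8, 27), (41, 41, 12), (41, 50, 31), (41, 60, 49), (42, 5, 32), (42, 40, 35), (43, 3, 23),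
    (43, 27, 16), (44, 9, 24), (44, 44, 13), (44, 52, 28), (44, 59, 55), (45, 35, 23),
    (45, 59, 21), (46, 3, 21), (46, 24, 18), (47, 5, 36), (47, 45, 39), (48, 3, 50), (48, 24, 52),
    (48, 31, 63), (48, 59, 56), (48, 63, 1), (48, 63, 4), (49, 1, 40), (49, 15, 15), (49, 34, 46),
    (49, 51, 19), (50, 12, 26), (50, 25, 62), (50, 55, 44), (51, 24, 21), (51, 27, 18),
    (52, 13, 25), (52, 26, 57), (52, 49, 41), (53, 24, 16), (53, 27, 23), (54, 3, 52),
    (54, 27, 50), (54, 28, 56), (54, 56, 1), (54, 56, 4), (54, 60, 63), (55, 1, 45), (55, 14, 14),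
    (55, 38, 43), (55, 53, 17), (56, 30, 35), (56, 51, 39), (57, 8, 45), (57, 20, 43),
    (57, 30, 17), (57, 57, 14), (58, 5, 39), (58, 40, 36), (59, 7, 54), (59, 63, 51), (60, 7, 48),
    (60, 56, 53), (61, 5, 35), (61, 45, 32), (62, 9, 40), (62, 22, 46), (62, 29, 19), (62, 62, 15),
    (63, 29, 39), (63, 53, 35)]

theorem length_points : points.length = 224 := by decide +kernel

theorem nodup_points : points.Nodup := by decide +kernel

theorem points_lt : ∀ p ∈ points, p.1 < 64 ∧ p.2.1 < 64 ∧ p.2.2 < 64 := by decide +kernel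

def Sext.left (x y z : Sext) : Sext :=
  (((y.prod y).prod z).sum (x.prod (z.prod z))).sum ((x.prod x).prod y)

def Sext.right (x y z : Sext) : Sext :=
  (((((x.prod (x.prod x)).sum (y.prod (y.prod y))).sum ((x.prod y).prod z)).sum
    (z.prod z)).sum z).sum (Sext.ofNat 1)

theorem points_left : ∀ p ∈ points,
    Sext.left (Sext.ofNat p.1) (Sext.ofNat p.2.1) (Sext.ofNat p.2.2) = Sext.ofNat 0 := by
  decide +kernel

theorem points_right : ∀ p ∈ points,
    Sext.right (Sext.ofNat p.1) (Sext.ofNat p.2.1) (Sext.ofNat p.2.2) = Sext.ofNat 0 := by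
  decide +kernel

theorem exists_primitive_elements [Fintype F] (hF : Fintype.card F = 64) :
    (2 : F) = 0 ∧ ∃ β ω : F, β ^ 3 = β + 1 ∧ ω ^ 2 = ω + 1 := by
  have h64 : (64 : F) = 0 := by exact_mod_cast hF ▸ Nat.cast_card_eq_zero F
  have h2 : (2 : F) = 0 := pow_eq_zero_iff (n := 6) (by norm_num) |>.1 (by linear_combination h64)
  have hunits : Nat.card Fˣ = 63 := by
    rw [Nat.card_units, Nat.card_eq_fintype_card, hF]
  have hroot : ∀ p : ℕ, p.Prime → p ∣ 63 → ∃ u : F, u ^ p = 1 ∧ u - 1 ≠ 0 := by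
    intro p hp hdvd
    have := Fact.mk hp
    obtain ⟨u, hu⟩ := exists_prime_orderOf_dvd_card' p (hunits ▸ hdvd)
    refine ⟨u, by rw [← Units.val_pow_eq_pow_val, ← hu, pow_orderOf_eq_one, Units.val_one], ?_⟩
    rw [sub_ne_zero, Ne, Units.val_eq_one, ← orderOf_eq_one_iff, hu]
    exact hp.ne_one
  obtain ⟨ω, hω, hω1⟩ := hroot 3 (by norm_num) (by norm_num)
  obtain ⟨u, hu, hu1⟩ := hroot 7 (by norm_num) (by norm_num)
  have hω' : ω ^ 2 + ω + 1 = 0 :=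
    (mul_eq_zero.1 (by linear_combination hω : (ω - 1) * (ω ^ 2 + ω + 1) = 0)).resolve_left hω1
  have hu' : (u ^ 3 + u + 1) * (u ^ 3 + u ^ 2 + 1) = 0 :=
    (mul_eq_zero.1 (by linear_combination hu + (u - 1) * u ^ 3 * h2 :
      (u - 1) * ((u ^ 3 + u + 1) * (u ^ 3 + u ^ 2 + 1)) = 0)).resolve_left hu1
  refine ⟨h2, ?_⟩
  rcases mul_eq_zero.1 hu' with h | h
  · exact ⟨u, ω, by linear_combination h - (u + 1) * h2,
      by linear_combination hω' - (ω + 1) * h2⟩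
  · exact ⟨u ^ 3, ω, by linear_combination u ^ 2 * hu + h - (u ^ 3 + 1) * h2,
      by linear_combination hω' - (ω + 1) * h2⟩

end RationalPoints

end GKCode

open GKCode in
theorem code_224_204_13
    (F : Type*) [Field F] [Fintype F] [DecidableEq F] (hF : Fintype.card F = 64) :
    ∃ C : Submodule F (Fin 224 → F),
      Module.finrank F C = 204 ∧
      ∀ x ∈ C, x ≠ 0 → 13 ≤ hammingNorm x := by
  obtain ⟨h2, β, ω, hβ, hω⟩ := exists_primitive_elements hF
  have hsum := Sext.eval_sum h2 β ω
  have hprod := Sext.eval_prod h2 hβ hω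
  let p : Fin 224 → ℕ × ℕ × ℕ := fun i => points.get (i.cast length_points.symm)
  have hp : ∀ i, p i ∈ points := fun i => List.get_mem _ _
  let x : Fin 224 → F := fun i => (Sext.ofNat (p i).1).eval β ω
  let y : Fin 224 → F := fun i => (Sext.ofNat (p i).2.1).eval β ω
  let z : Fin 224 → F := fun i => (Sext.ofNat (p i).2.2).eval β ω
  have hcurve : OnCurve x y z := by
    refine ⟨funext fun _ => h2, funext fun i => ?_, funext fun i => ?_⟩
    · have := congrArg (Sext.eval β ω) (points_left _ (hp i))
      simp only [Sext.left, hsum, hprod, Sext.eval_ofNat_zero] at this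
      simp only [x, y, z, Pi.add_apply, Pi.mul_apply, Pi.pow_apply, Pi.zero_apply]
      linear_combination this
    · have := congrArg (Sext.eval β ω) (points_right _ (hp i))
      simp only [Sext.right, hsum, hprod, Sext.eval_ofNat_zero, Sext.eval_ofNat_one] at this
      simp only [x, y, z, Pi.add_apply, Pi.mul_apply, Pi.pow_apply, Pi.zero_apply, Pi.one_apply]
      linear_combination this
  have hinj : Function.Injective fun i => (x i, y i, z i) := by
    intro i j hij
    simp only [Prod.mk.injEq] at hij
    have heval := Sext.eval_injective h2 hβ hω
    obtain ⟨hi₁, hi₂, hi₃⟩ := points_lt _ (hp i)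
    obtain ⟨hj₁, hj₂, hj₃⟩ := points_lt _ (hp j)
    have hpij : p i = p j := Prod.ext (Sext.ofNat_injOn hi₁ hj₁ (heval hij.1))
      (Prod.ext (Sext.ofNat_injOn hi₂ hj₂ (heval hij.2.1))
        (Sext.ofNat_injOn hi₃ hj₃ (heval hij.2.2)))
    exact Fin.cast_injective _ (List.nodup_iff_injective_get.1 nodup_points hpij)
  simpa using hcurve.exists_code hinj
end

section
/- Let F be a finite field with 64 elements. There exists an F-linear subspace C of F^{224} of dimension 202 such that every nonzero element of C has Hamming weight at least 14; i.e., a linear [224, 202, ≥14]-code over F_{64} exists. -/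
open Polynomial in
/-- A divisor of `X ^ q - X` over the field with `q` elements has as many roots as its degree. -/
theorem card_filter_eval_eq_zero_of_dvd {F : Type*} [Field F] [Fintype F] [DecidableEq F]
    {p : F[X]} (hp : p ∣ X ^ Fintype.card F - X) :
    (Finset.univ.filter fun a => p.eval a = 0).card = p.natDegree := by
  have h0 : (X ^ Fintype.card F - X : F[X]) ≠ 0 :=
    FiniteField.X_pow_card_sub_X_ne_zero F Fintype.one_lt_card
  have hroots := FiniteField.roots_X_pow_card_sub_X F
  have hs : (X ^ Fintype.card F - X : F[X]).Splits := by
    rw [splits_iff_card_roots, hroots,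
      FiniteField.X_pow_card_sub_X_natDegree_eq F Fintype.one_lt_card]
    rfl
  have hp0 : p ≠ 0 := ne_zero_of_dvd_ne_zero h0 hp
  have hnd : p.roots.Nodup :=
    Multiset.nodup_of_le (roots.le_of_dvd h0 hp) (hroots ▸ Finset.univ.nodup)
  rw [(hs.of_dvd h0 hp).natDegree_eq_card_roots, ← Multiset.toFinset_card_of_nodup hnd]
  congr 1
  ext a
  simp [hp0]

theorem trace_z_cubed_eq_zero {F : Type*} [Field F] (h2 : (2 : F) = 0) {z : F}
    (hz : z ^ 28 + z ^ 19 + z = 0) :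
    z ^ 3 + (z ^ 3) ^ 4 + (z ^ 3) ^ 16 = 0 := by
  linear_combination z ^ 2 * (z ^ 18 + z ^ 9 + 1) * hz - (z ^ 39 + z ^ 30 + z ^ 21) * h2

theorem trace_y_cubed_eq_zero {F : Type*} [Field F] (h2 : (2 : F) = 0) {y z : F}
    (hz : z ^ 28 + z ^ 19 + z = 0) (hy : y ^ 4 + y + z ^ 3 = 0) :
    y ^ 3 + (y ^ 3) ^ 2 + (y ^ 3) ^ 4 + (y ^ 3) ^ 8 + (y ^ 3) ^ 16 + (y ^ 3) ^ 32 = 0 := by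
  have : CharP F 2 := CharTwo.of_one_ne_zero_of_two_eq_zero one_ne_zero h2
  have hsq (a b : F) : (a + b) ^ 2 = a ^ 2 + b ^ 2 := CharTwo.add_sq a b
  have htr := trace_z_cubed_eq_zero h2 hz
  have ht : (z ^ 3) ^ 12 + (z ^ 3) ^ 9 + (z ^ 3) ^ 3 = 0 := by
    linear_combination z ^ 8 * hz
  generalize z ^ 3 = w at *
  have hy4 : y ^ 4 = y + w := by linear_combination hy - (y + w) * h2
  have hy16 : y ^ 16 = y + w ^ 16 := by
    have : y ^ 16 = y ^ 4 + w ^ 4 := by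
      rw [show y ^ 16 = ((y ^ 4) ^ 2) ^ 2 by ring, hy4, hsq, hsq, ← hy4]; ring
    linear_combination this + hy4 + htr - w ^ 16 * h2
  have hw24 : w ^ 24 = w ^ 3 := by
    linear_combination (w ^ 9 + w ^ 3 + 1) * (w ^ 3 + 1) * ht -
      (w ^ 21 + w ^ 18 + 2 * w ^ 15 + 2 * w ^ 12 + w ^ 9 + w ^ 6 + w ^ 3) * h2
  have hw48 : w ^ 48 = w ^ 6 := by
    rw [show 48 = 24 * 2 from rfl, pow_mul, hw24]; ring
  have htr4 : y ^ 3 + (y ^ 3) ^ 4 + (y ^ 3) ^ 16 =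
      y ^ 3 + y ^ 2 * w ^ 4 + y * w ^ 8 + w ^ 3 + w ^ 6 := by
    have e4 : (y ^ 3) ^ 4 = (y + w) ^ 3 := by rw [← hy4]; ring
    have e16 : (y ^ 3) ^ 16 = (y + w ^ 16) ^ 3 := by rw [← hy16]; ring
    have htr2 : w ^ 2 + w ^ 8 + w ^ 32 = 0 := by
      linear_combination (w + w ^ 4 + w ^ 16) * htr - (w ^ 5 + w ^ 17 + w ^ 20) * h2
    rw [e4, e16]
    linear_combination 3 * y ^ 2 * htr + 3 * y * htr2 + hw48 +
      (y ^ 3 - 2 * y ^ 2 * w ^ 4 - 2 * y * w ^ 8) * h2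
  have key : (y ^ 3 + (y ^ 3) ^ 4 + (y ^ 3) ^ 16) + (y ^ 3 + (y ^ 3) ^ 4 + (y ^ 3) ^ 16) ^ 2 =
      0 := by
    rw [htr4, hsq, hsq, hsq, hsq]
    linear_combination (y ^ 2 + w ^ 8) * hy4 + y ^ 2 * htr + ht + (y ^ 3 + y * w ^ 8 + w ^ 6) * h2
  rw [hsq, hsq] at key
  linear_combination key

section PointCount

open Polynomial

variable {F : Type*} [Field F] [Fintype F]

theorem two_eq_zero_of_card_eq_64 (hF : Fintype.card F = 64) : (2 : F) = 0 := by
  have h : ((64 : ℕ) : F) = 0 := by rw [← hF]; exact FiniteField.cast_card_eq_zero F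
  have h' : (2 : F) ^ 6 = 0 := by rw [← h]; norm_num
  exact pow_eq_zero_iff (by norm_num) |>.1 h'

theorem polynomial_two_eq_zero_of_card_eq_64 (hF : Fintype.card F = 64) : (2 : F[X]) = 0 := by
  rw [← C_ofNat, two_eq_zero_of_card_eq_64 hF, C_0]

variable [DecidableEq F]

/-- The number of `z`-coordinates of affine rational points of the GK curve. -/
theorem card_gk_z (hF : Fintype.card F = 64) :
    (Finset.univ.filter fun z : F => z ^ 28 + z ^ 19 + z = 0).card = 28 := by
  have h2 := polynomial_two_eq_zero_of_card_eq_64 hF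
  have hdvd : (X ^ 28 + X ^ 19 + X : F[X]) ∣ X ^ Fintype.card F - X := by
    rw [hF]
    refine ⟨(X ^ 27 + X ^ 9 + 1) * (X ^ 9 + 1), ?_⟩
    linear_combination (-(X + X ^ 10 + X ^ 19 + 2 * X ^ 28 + 2 * X ^ 37 + X ^ 46 + X ^ 55) : F[X]) * h2
  have := card_filter_eval_eq_zero_of_dvd hdvd
  simp only [eval_add, eval_pow, eval_X] at this
  rw [this]
  compute_degree!

/-- Over each admissible `z` there are four values of `y`. -/
theorem card_gk_y (hF : Fintype.card F = 64) {z : F} (hz : z ^ 28 + z ^ 19 + z = 0) :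
    (Finset.univ.filter fun y : F => y ^ 4 + y + z ^ 3 = 0).card = 4 := by
  have h2 := polynomial_two_eq_zero_of_card_eq_64 hF
  have h2' := two_eq_zero_of_card_eq_64 hF
  set w := z ^ 3
  have htr : w + w ^ 4 + w ^ 16 = 0 := trace_z_cubed_eq_zero h2' hz
  have hdvd : (X ^ 4 + X + C w : F[X]) ∣ X ^ Fintype.card F - X := by
    rw [hF]
    have : CharP F[X] 2 := CharTwo.of_one_ne_zero_of_two_eq_zero one_ne_zero h2
    have hsq (a b : F[X]) : (a + b) ^ 2 = a ^ 2 + b ^ 2 := CharTwo.add_sq a b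
    have h4 : (X ^ 4 + X + C w : F[X]) ^ 4 = X ^ 16 + X ^ 4 + C w ^ 4 := by
      rw [show 4 = 2 * 2 from rfl, pow_mul, hsq, hsq, hsq, hsq]; ring
    have h16 : (X ^ 4 + X + C w : F[X]) ^ 16 = X ^ 64 + X ^ 16 + C w ^ 16 := by
      rw [show 16 = 4 * 2 * 2 from rfl, pow_mul, pow_mul, h4, hsq, hsq, hsq, hsq]; ring
    have htr' : C w + C w ^ 4 + C w ^ 16 = 0 := by
      simpa using congrArg C htr
    refine ⟨(X ^ 4 + X + C w) ^ 15 + (X ^ 4 + X + C w) ^ 3 + 1, ?_⟩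
    linear_combination -h16 - h4 - htr' - (X ^ 16 + X ^ 4 + X) * h2
  have := card_filter_eval_eq_zero_of_dvd hdvd
  simp only [eval_add, eval_pow, eval_X, eval_C] at this
  rw [this]
  compute_degree!

/-- Over each admissible `(y, z)` there are two values of `x`. -/
theorem card_gk_x (hF : Fintype.card F = 64) {y z : F} (hz : z ^ 28 + z ^ 19 + z = 0)
    (hy : y ^ 4 + y + z ^ 3 = 0) :
    (Finset.univ.filter fun x : F => x ^ 2 + x + y ^ 3 = 0).card = 2 := by
  have h2 := polynomial_two_eq_zero_of_card_eq_64 hF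
  have h2' := two_eq_zero_of_card_eq_64 hF
  set u := y ^ 3
  have htr : u + u ^ 2 + u ^ 4 + u ^ 8 + u ^ 16 + u ^ 32 = 0 :=
    trace_y_cubed_eq_zero h2' hz hy
  have hdvd : (X ^ 2 + X + C u : F[X]) ∣ X ^ Fintype.card F - X := by
    rw [hF]
    have : CharP F[X] 2 := CharTwo.of_one_ne_zero_of_two_eq_zero one_ne_zero h2
    have hsq (a b : F[X]) : (a + b) ^ 2 = a ^ 2 + b ^ 2 := CharTwo.add_sq a b
    have hstep (n : ℕ) (h : (X ^ 2 + X + C u : F[X]) ^ n = X ^ (2 * n) + X ^ n + C u ^ n) :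
        (X ^ 2 + X + C u : F[X]) ^ (n * 2) = X ^ (2 * (n * 2)) + X ^ (n * 2) + C u ^ (n * 2) := by
      rw [pow_mul, h, hsq, hsq]; ring
    have e1 := hstep 1 (by ring)
    have e2 := hstep _ e1
    have e4 := hstep _ e2
    have e8 := hstep _ e4
    have e16 := hstep _ e8
    norm_num only at e1 e2 e4 e8 e16
    have htr' : C u + C u ^ 2 + C u ^ 4 + C u ^ 8 + C u ^ 16 + C u ^ 32 = 0 := by
      simpa using congrArg C htr
    refine ⟨(X ^ 2 + X + C u) ^ 31 + (X ^ 2 + X + C u) ^ 15 + (X ^ 2 + X + C u) ^ 7 +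
      (X ^ 2 + X + C u) ^ 3 + (X ^ 2 + X + C u) + 1, ?_⟩
    linear_combination -e1 - e2 - e4 - e8 - e16 - htr' -
      (X ^ 32 + X ^ 16 + X ^ 8 + X ^ 4 + X ^ 2 + X) * h2
  have := card_filter_eval_eq_zero_of_dvd hdvd
  simp only [eval_add, eval_pow, eval_X, eval_C] at this
  rw [this]
  compute_degree!

/-- The GK curve over the field with 64 elements has 224 affine rational points. -/
theorem exists_gk_points (hF : Fintype.card F = 64) :
    ∃ x y z : Fin 224 → F, (∀ p, x p ^ 2 = y p ^ 3 + x p) ∧ (∀ p, z p ^ 3 = y p ^ 4 + y p) ∧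
      Function.Injective fun p => ![x p, y p, z p] := by
  have h2 := two_eq_zero_of_card_eq_64 hF
  let S : Finset (Σ _ : F, Σ _ : F, F) :=
    (Finset.univ.filter fun z : F => z ^ 28 + z ^ 19 + z = 0).sigma fun z =>
      (Finset.univ.filter fun y : F => y ^ 4 + y + z ^ 3 = 0).sigma fun y =>
        Finset.univ.filter fun x : F => x ^ 2 + x + y ^ 3 = 0
  have hS : S.card = 224 := by
    rw [Finset.card_sigma, Finset.sum_congr rfl (g := fun _ => 8), Finset.sum_const, card_gk_z hF]
    · rfl
    intro z hz
    have hz' := (Finset.mem_filter.1 hz).2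
    rw [Finset.card_sigma, Finset.sum_congr rfl (g := fun _ => 2), Finset.sum_const,
      card_gk_y hF hz']
    · rfl
    intro y hy
    exact card_gk_x hF hz' (Finset.mem_filter.1 hy).2
  let e := (S.equivFinOfCardEq hS).symm
  have he (p : Fin 224) := (e p).2
  simp only [S, Finset.mem_sigma, Finset.mem_filter, Finset.mem_univ, true_and] at he
  refine ⟨fun p => (e p).1.2.2, fun p => (e p).1.2.1, fun p => (e p).1.1, fun p => ?_, fun p => ?_,
    fun p q hpq => ?_⟩
  · linear_combination (he p).2.2 - ((e p).1.2.2 + (e p).1.2.1 ^ 3) * h2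
  · linear_combination (he p).2.1 - ((e p).1.2.1 ^ 4 + (e p).1.2.1) * h2
  · have hx := congrFun hpq 0
    have hy := congrFun hpq 1
    have hz := congrFun hpq 2
    simp at hx hy hz
    apply e.injective
    apply Subtype.ext
    generalize (e p).1 = a at *
    generalize (e q).1 = b at *
    obtain ⟨a1, a2, a3⟩ := a
    obtain ⟨b1, b2, b3⟩ := b
    simp_all

end PointCount

section Moments

variable {F ι : Type*} [Field F] [Fintype ι] {x y z : ι → F}

/-- The pairing of a word `c` with the monomial `x ^ k * y ^ i * z ^ j`. -/
def moment (x y z c : ι → F) (k i j : ℕ) : F :=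
  ∑ p, c p * (x p ^ k * y p ^ i * z p ^ j)

theorem moment_x_add_two (hx : ∀ p, x p ^ 2 = y p ^ 3 + x p) (c : ι → F) (k i j : ℕ) :
    moment x y z c (k + 2) i j = moment x y z c k (i + 3) j + moment x y z c (k + 1) i j := by
  simp only [moment, ← Finset.sum_add_distrib]
  refine Finset.sum_congr rfl fun p _ => ?_
  rw [pow_add, hx]
  ring

theorem moment_z_add_three (hz : ∀ p, z p ^ 3 = y p ^ 4 + y p) (c : ι → F) (k i j : ℕ) :
    moment x y z c k i (j + 3) = moment x y z c k (i + 4) j + moment x y z c k (i + 1) j := by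
  simp only [moment, ← Finset.sum_add_distrib]
  refine Finset.sum_congr rfl fun p _ => ?_
  rw [pow_add _ _ 3, hz]
  ring

/-- If all moments of weight less than `s` vanish, a moment of weight `s` is unchanged when its
monomial is replaced by the reduced monomial of the same weight. -/
theorem moment_eq_reduced (hx : ∀ p, x p ^ 2 = y p ^ 3 + x p)
    (hz : ∀ p, z p ^ 3 = y p ^ 4 + y p) (c : ι → F) {s : ℕ}
    (hs : ∀ k i j, 9 * k + 6 * i + 8 * j < s → moment x y z c k i j = 0) (k i j : ℕ)
    (h : 9 * k + 6 * i + 8 * j = s) :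
    moment x y z c k i j =
      moment x y z c (s % 2) ((s - 9 * (s % 2) - 8 * (2 * s % 3)) / 6) (2 * s % 3) := by
  induction k using Nat.strong_induction_on generalizing i j with
  | _ k ihk =>
  by_cases hk : 2 ≤ k
  · obtain ⟨k, rfl⟩ := Nat.exists_eq_add_of_le' hk
    rw [moment_x_add_two hx, hs (k + 1) i j (by omega), add_zero]
    exact ihk k (by omega) _ _ (by omega)
  induction j using Nat.strong_induction_on generalizing i with
  | _ j ihj =>
  by_cases hj : 3 ≤ j
  · obtain ⟨j, rfl⟩ := Nat.exists_eq_add_of_le' hj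
    rw [moment_z_add_three hz, hs k (i + 1) j (by omega), add_zero]
    exact ihj j (by omega) _ (by omega)
  have e1 : k = s % 2 := by omega
  have e2 : j = 2 * s % 3 := by omega
  have e3 : i = (s - 9 * (s % 2) - 8 * (2 * s % 3)) / 6 := by omega
  rw [← e1, ← e2] at *
  rw [← e3]

/-- A word orthogonal to all monomials vanishes when the points are distinct. -/
theorem eq_zero_of_moment_eq_zero [Fintype F]
    (hinj : Function.Injective fun p => ![x p, y p, z p]) {c : ι → F}
    (hc : ∀ k i j, moment x y z c k i j = 0) : c = 0 := by
  classical
  have key (f : MvPolynomial (Fin 3) F) :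
      ∑ p, c p * MvPolynomial.eval ![x p, y p, z p] f = 0 := by
    induction f using MvPolynomial.induction_on' with
    | monomial m a =>
      have := congrArg (a * ·) (hc (m 0) (m 1) (m 2))
      simp only [moment, Finset.mul_sum, mul_zero] at this
      rw [← this]
      refine Finset.sum_congr rfl fun p _ => ?_
      rw [MvPolynomial.eval_monomial, Finsupp.prod_fintype _ _ (by simp), Fin.prod_univ_three]
      simp
      ring
    | add f g hf hg => simp only [map_add, mul_add, Finset.sum_add_distrib, hf, hg, add_zero]
  funext q
  have hq := key (MvPolynomial.indicator ![x q, y q, z q])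
  rw [Finset.sum_eq_single q, MvPolynomial.eval_indicator_apply_eq_one, mul_one] at hq
  · exact hq
  · intro p _ hp
    rw [MvPolynomial.eval_indicator_apply_eq_zero, mul_zero]
    exact fun h => hp (hinj h)
  · simp

/-- The elements of the numerical semigroup generated by `6`, `8` and `9`. -/
def IsPole (a : ℕ) : Prop := 9 * (a % 2) + 8 * (2 * a % 3) ≤ a

instance : DecidablePred IsPole := fun a => inferInstanceAs (Decidable (_ ≤ a))

/-- The exponent of `y` in the reduced monomial of weight `a`. -/
def yExp (a : ℕ) : ℕ := (a - 9 * (a % 2) - 8 * (2 * a % 3)) / 6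

theorem IsPole.weight_eq {a : ℕ} (ha : IsPole a) :
    9 * (a % 2) + 6 * yExp a + 8 * (2 * a % 3) = a := by
  unfold IsPole yExp at *
  omega

theorem isPole_of_weight_eq {k i j a : ℕ} (h : 9 * k + 6 * i + 8 * j = a) : IsPole a := by
  unfold IsPole
  obtain h2 | h2 : a % 2 = 0 ∨ a % 2 = 1 := by omega
  all_goals
    obtain h3 | h3 | h3 : 2 * a % 3 = 0 ∨ 2 * a % 3 = 1 ∨ 2 * a % 3 = 2 := by omega
    all_goals
      rw [h2, h3]
      omega

/-- The Feng–Rao count: every weight from `32` on is the sum of at least `14` pairs of poles. -/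
theorem fourteen_le_card_pole_pairs {s : ℕ} (hs : 32 ≤ s) :
    14 ≤ ((Finset.range (s + 1)).filter fun a => IsPole a ∧ IsPole (s - a)).card := by
  obtain rfl | hs := hs.eq_or_lt
  · decide
  let G : Finset ℕ := {1, 2, 3, 4, 5, 7, 10, 11, 13, 19}
  have hG (a : ℕ) (ha : a ∉ G) : IsPole a := by
    simp only [G, Finset.mem_insert, Finset.mem_singleton, not_or] at ha
    unfold IsPole
    obtain h2 | h2 : a % 2 = 0 ∨ a % 2 = 1 := by omega
    all_goals
      obtain h3 | h3 | h3 : 2 * a % 3 = 0 ∨ 2 * a % 3 = 1 ∨ 2 * a % 3 = 2 := by omega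
      all_goals
        rw [h2, h3]
        omega
  have hsub : Finset.range (s + 1) \ (G ∪ G.image (s - ·)) ⊆
      (Finset.range (s + 1)).filter fun a => IsPole a ∧ IsPole (s - a) := by
    intro a ha
    simp only [Finset.mem_sdiff, Finset.mem_union, Finset.mem_image, not_or, not_exists,
      not_and] at ha
    refine Finset.mem_filter.2 ⟨ha.1, hG _ ha.2.1, hG _ fun h => ha.2.2 _ h ?_⟩
    have := Finset.mem_range.1 ha.1
    omega
  have h1 := Finset.card_le_card hsub
  have h2 := Finset.le_card_sdiff (G ∪ G.image (s - ·)) (Finset.range (s + 1))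
  have h3 := Finset.card_union_le G (G.image (s - ·))
  have h4 : (G.image (s - ·)).card ≤ G.card := Finset.card_image_le
  have h5 : G.card = 10 := rfl
  rw [Finset.card_range] at h2
  omega

/-- The order bound at weight `s`, the least weight of a nonvanishing moment. -/
theorem card_pole_pairs_le_hammingNorm [DecidableEq F] (c : ι → F) {s : ℕ}
    (hs : ∀ k i j, 9 * k + 6 * i + 8 * j < s → moment x y z c k i j = 0)
    (hne : ∀ k i j, 9 * k + 6 * i + 8 * j = s → moment x y z c k i j ≠ 0) :
    ((Finset.range (s + 1)).filter fun a => IsPole a ∧ IsPole (s - a)).card ≤ hammingNorm c := by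
  set A := (Finset.range (s + 1)).filter fun a => IsPole a ∧ IsPole (s - a)
  let v (a : A) (p : {p // c p ≠ 0}) : F :=
    x p ^ (a.1 % 2) * y p ^ yExp a * z p ^ (2 * a.1 % 3)
  have hv : LinearIndependent F v := by
    rw [Fintype.linearIndependent_iff]
    intro g hg
    by_contra! hcon
    obtain ⟨a, ha, hmax⟩ := (Finset.univ.filter fun a => g a ≠ 0).exists_max_image Subtype.val
      (by simpa [Finset.Nonempty] using hcon)
    replace ha : g a ≠ 0 := (Finset.mem_filter.1 ha).2
    have haA := (Finset.mem_filter.1 a.2).2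
    set b := s - a.1
    have has : a.1 ≤ s := Nat.lt_succ_iff.1 (Finset.mem_range.1 (Finset.mem_filter.1 a.2).1)
    have hsum : ∑ a' : A, g a' * moment x y z c (a'.1 % 2 + b % 2) (yExp a' + yExp b)
        (2 * a'.1 % 3 + 2 * b % 3) = 0 := by
      simp only [moment, Finset.mul_sum]
      rw [Finset.sum_comm]
      refine Finset.sum_eq_zero fun p _ => ?_
      by_cases hp : c p = 0
      · simp [hp]
      have := congrFun hg ⟨p, hp⟩
      simp only [Finset.sum_apply, Pi.smul_apply, smul_eq_mul, v, Pi.zero_apply] at this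
      rw [← mul_zero (c p * (x p ^ (b % 2) * y p ^ yExp b * z p ^ (2 * b % 3))), ← this,
        Finset.mul_sum]
      refine Finset.sum_congr rfl fun a' _ => ?_
      ring
    have hwb := haA.2.weight_eq
    rw [Finset.sum_eq_single a] at hsum
    · have hwa := haA.1.weight_eq
      exact mul_ne_zero ha (hne _ _ _ (by omega)) hsum
    · intro a' _ ha'
      by_cases hg' : g a' = 0
      · rw [hg', zero_mul]
      have hle := hmax a' (by simpa using hg')
      have hlt : a'.1 < a.1 := lt_of_le_of_ne hle fun h => ha' (Subtype.ext h)
      have hwa := (Finset.mem_filter.1 a'.2).2.1.weight_eq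
      rw [hs _ _ _ (by omega), mul_zero]
    · simp
  have := hv.fintype_card_le_finrank
  rwa [Module.finrank_fintype_fun_eq_card, Fintype.card_coe, Fintype.card_subtype] at this

end Moments

/-- A subspace contains subspaces of every smaller dimension. -/
theorem Submodule.exists_le_finrank_eq {K V : Type*} [Field K] [AddCommGroup V] [Module K V]
    [FiniteDimensional K V] (W : Submodule K V) {n : ℕ} (hn : n ≤ Module.finrank K W) :
    ∃ U ≤ W, Module.finrank K U = n := by
  let b := Module.finBasis K W
  have hli : LinearIndependent K fun i : Fin n => (b (Fin.castLE hn i) : V) :=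
    (b.linearIndependent.comp _ (Fin.castLE_injective hn)).map' W.subtype W.ker_subtype
  refine ⟨Submodule.span K (Set.range fun i : Fin n => (b (Fin.castLE hn i) : V)), ?_, ?_⟩
  · rw [Submodule.span_le]
    rintro _ ⟨i, rfl⟩
    exact (b _).2
  · rw [finrank_span_eq_card hli, Fintype.card_fin]

theorem code_224_202_14
    (F : Type*) [Field F] [Fintype F] [DecidableEq F] (hF : Fintype.card F = 64) :
    ∃ C : Submodule F (Fin 224 → F),
      Module.finrank F C = 202 ∧
      ∀ x ∈ C, x ≠ 0 → 14 ≤ hammingNorm x := by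
  obtain ⟨x, y, z, hx, hz, hinj⟩ := exists_gk_points hF
  let T := (Finset.range 32).filter IsPole
  let φ : (Fin 224 → F) →ₗ[F] (T → F) :=
    { toFun := fun c a => moment x y z c (a.1 % 2) (yExp a) (2 * a.1 % 3)
      map_add' := fun c d => by
        funext a
        simp [moment, add_mul, Finset.sum_add_distrib]
      map_smul' := fun r c => by
        funext a
        simp [moment, Finset.mul_sum, mul_assoc] }
  have hT : T.card = 22 := by decide
  have hdim : 202 ≤ Module.finrank F (LinearMap.ker φ) := by
    have h1 := φ.finrank_range_add_finrank_ker
    have h2 := (LinearMap.range φ).finrank_le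
    rw [Module.finrank_fintype_fun_eq_card, Fintype.card_coe, hT] at h2
    rw [Module.finrank_fintype_fun_eq_card, Fintype.card_fin] at h1
    omega
  obtain ⟨C, hC, hCdim⟩ := Submodule.exists_le_finrank_eq _ hdim
  refine ⟨C, hCdim, fun c hcC hc0 => ?_⟩
  have hφ : φ c = 0 := hC hcC
  have hex : ∃ s k i j, 9 * k + 6 * i + 8 * j = s ∧ moment x y z c k i j ≠ 0 := by
    by_contra! h
    exact hc0 (eq_zero_of_moment_eq_zero hinj fun k i j => h _ k i j rfl)
  classical
  obtain ⟨s, ⟨k, i, j, hw, hm⟩, hmin⟩ : ∃ s, (∃ k i j, 9 * k + 6 * i + 8 * j = s ∧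
      moment x y z c k i j ≠ 0) ∧ ∀ k i j, 9 * k + 6 * i + 8 * j < s →
        moment x y z c k i j = 0 := by
    refine ⟨Nat.find hex, Nat.find_spec hex, fun k i j h => ?_⟩
    by_contra h'
    exact Nat.find_min hex h ⟨k, i, j, rfl, h'⟩
  have hred := moment_eq_reduced hx hz c hmin
  rw [hred k i j hw] at hm
  have hs : 32 ≤ s := by
    by_contra! hlt
    exact hm (congrFun hφ
      ⟨s, Finset.mem_filter.2 ⟨Finset.mem_range.2 hlt, isPole_of_weight_eq hw⟩⟩)
  exact (fourteen_le_card_pole_pairs hs).trans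
    (card_pole_pairs_le_hammingNorm c hmin fun k i j h => hred k i j h ▸ hm)
end

section
/- Let F be a finite field with 729 elements. There exists an F-linear subspace C of F^{6075} of dimension at least 5780 such that every nonzero element of C has Hamming weight at least 198; i.e., a linear [6075, 5780, ≥198]-code over F_{729} exists. -/
namespace GKCode

open Polynomial in
/-- A divisor of `X ^ q - X` over the field with `q` elements has as many roots as its degree. -/
theorem card_roots_of_dvd_X_pow_card_sub_X {F : Type*} [Field F] [Fintype F] [DecidableEq F]
    {P : F[X]} (h : P ∣ X ^ Fintype.card F - X) :
    (Finset.univ.filter fun x => P.eval x = 0).card = P.natDegree := by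
  have hne : (X ^ Fintype.card F - X : F[X]) ≠ 0 :=
    FiniteField.X_pow_card_sub_X_ne_zero F Fintype.one_lt_card
  have hP : P ≠ 0 := ne_zero_of_dvd_ne_zero hne h
  have hsplit : (X ^ Fintype.card F - X : F[X]).Splits := by
    rw [splits_iff_card_roots, FiniteField.roots_X_pow_card_sub_X,
      FiniteField.X_pow_card_sub_X_natDegree_eq F Fintype.one_lt_card]
    rfl
  have hnodup : P.roots.Nodup := by
    refine Multiset.nodup_of_le (Polynomial.roots.le_of_dvd hne h) ?_
    rw [FiniteField.roots_X_pow_card_sub_X]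
    exact Finset.univ.nodup
  rw [(hsplit.of_dvd hne h).natDegree_eq_card_roots, ← Multiset.toFinset_card_of_nodup hnodup]
  congr 1
  ext x
  simp [hP]

/-- The order bound: a vector pairing triangularly and nondegenerately with the products
`f a * g b` has weight at least the number of indices. -/
theorem card_le_hammingNorm {F ι : Type*} [Field F] [Fintype ι] [DecidableEq F]
    (T : Finset ℕ) (v : ι → F) (f g : ℕ → ι → F)
    (hdiag : ∀ a ∈ T, ∑ i, v i * (f a i * g a i) ≠ 0)
    (hlow : ∀ a ∈ T, ∀ b ∈ T, a < b → ∑ i, v i * (f a i * g b i) = 0) :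
    T.card ≤ hammingNorm v := by
  have hind : LinearIndependent F
      (fun (a : T) (i : {i // v i ≠ 0}) => f a i) := by
    rw [Fintype.linearIndependent_iff]
    intro c hc
    by_contra! hne
    obtain ⟨b, hb, hmax⟩ := Finset.exists_max_image
      (Finset.univ.filter fun a : T => c a ≠ 0) (fun a => (a : ℕ))
      (by obtain ⟨a, ha⟩ := hne; exact ⟨a, by simpa using ha⟩)
    have hb' : c b ≠ 0 := by simpa using hb
    have hzero : ∀ i, v i * g b i * ∑ a : T, c a * f a i = 0 := by
      intro i
      by_cases hi : v i = 0
      · simp [hi]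
      · have := congrFun hc ⟨i, hi⟩
        simp only [Finset.sum_apply, Pi.smul_apply, smul_eq_mul, Pi.zero_apply] at this
        rw [this, mul_zero]
    have hsum : ∑ a : T, c a * ∑ i, v i * (f a i * g b i) = 0 := by
      calc _ = ∑ i, v i * g b i * ∑ a : T, c a * f a i := by
            simp_rw [Finset.mul_sum]
            rw [Finset.sum_comm]
            exact Finset.sum_congr rfl fun i _ => Finset.sum_congr rfl fun a _ => by ring
        _ = 0 := Finset.sum_eq_zero fun i _ => hzero i
    rw [Finset.sum_eq_single b] at hsum
    · exact (mul_ne_zero hb' (hdiag b b.2)) hsum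
    · intro a _ hab
      by_cases ha : c a = 0
      · simp [ha]
      · have hle := hmax a (by simpa using ha)
        have hlt : (a : ℕ) < b := lt_of_le_of_ne hle fun h => hab (Subtype.ext h)
        rw [hlow a a.2 b b.2 hlt, mul_zero]
    · simp
  have := hind.fintype_card_le_finrank
  simpa [hammingNorm, Fintype.card_subtype] using this

/-- The exponent of `z` in the normal monomial `x ^ a * y ^ b * z ^ c`, `b < 4`, `c < 7`, of pole
order `s = 28 * a + 21 * b + 27 * c`. -/
def expZ (s : ℕ) : ℕ := 6 * s % 7

/-- The exponent of `y` in the normal monomial of pole order `s`. -/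
def expY (s : ℕ) : ℕ := 3 * ((s - 27 * expZ s) / 7) % 4

/-- The exponent of `x` in the normal monomial of pole order `s`. -/
def expX (s : ℕ) : ℕ := (s - 27 * expZ s - 21 * expY s) / 28

/-- Membership in the numerical semigroup generated by `21`, `27` and `28`. -/
def IsPoleOrder (s : ℕ) : Prop := 28 * expX s + 21 * expY s + 27 * expZ s = s

instance : DecidablePred IsPoleOrder := fun s =>
  inferInstanceAs (Decidable (28 * expX s + 21 * expY s + 27 * expZ s = s))

theorem exps_of_weight {a b c : ℕ} (hb : b < 4) (hc : c < 7) :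
    expX (28 * a + 21 * b + 27 * c) = a ∧ expY (28 * a + 21 * b + 27 * c) = b ∧
      expZ (28 * a + 21 * b + 27 * c) = c := by
  have hz : expZ (28 * a + 21 * b + 27 * c) = c := by unfold expZ; omega
  have hy : expY (28 * a + 21 * b + 27 * c) = b := by unfold expY; rw [hz]; omega
  refine ⟨?_, hy, hz⟩
  unfold expX; rw [hy, hz]; omega

theorem isPoleOrder_of_le {s : ℕ} (hs : 198 ≤ s) : IsPoleOrder s := by
  unfold IsPoleOrder expX expY
  have h : expZ s = 6 * s % 7 := rfl
  generalize expZ s = c at h ⊢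
  omega

theorem card_gaps : ((Finset.range 198).filter fun a => ¬ IsPoleOrder a).card = 99 := by
  decide +kernel

theorem card_poleOrders : ((Finset.range 394).filter IsPoleOrder).card = 295 := by
  decide +kernel

theorem le_card_decompositions {s : ℕ} (hs : 394 ≤ s) :
    198 ≤ ((Finset.range (s + 1)).filter fun a => IsPoleOrder a ∧ IsPoleOrder (s - a)).card := by
  rcases hs.eq_or_lt with rfl | hs
  · decide +kernel
  set G := (Finset.range 198).filter fun a => ¬ IsPoleOrder a with hG
  have hmem : ∀ a, ¬ IsPoleOrder a → a ∈ G := fun a ha => by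
    simp only [hG, Finset.mem_filter, Finset.mem_range]
    exact ⟨not_le.1 fun h => ha (isPoleOrder_of_le h), ha⟩
  have hsub : (Finset.range (s + 1)).filter (fun a => ¬ (IsPoleOrder a ∧ IsPoleOrder (s - a))) ⊆
      G ∪ G.image (fun a => s - a) := by
    intro a ha
    simp only [Finset.mem_filter, Finset.mem_range, not_and_or] at ha
    rw [Finset.mem_union, Finset.mem_image]
    rcases ha.2 with h | h
    · exact Or.inl (hmem a h)
    · exact Or.inr ⟨s - a, hmem _ h, by omega⟩
  have h1 := (Finset.card_le_card hsub).trans (Finset.card_union_le _ _)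
  have h2 : (G.image (fun a => s - a)).card ≤ G.card := Finset.card_image_le
  have h3 : G.card = 99 := card_gaps
  have h4 := Finset.card_filter_add_card_filter_not (s := Finset.range (s + 1))
    (fun a => IsPoleOrder a ∧ IsPoleOrder (s - a))
  rw [Finset.card_range] at h4
  omega

/-- If a functional on the coordinate ring vanishes on monomials of pole order less than `s`, then
it takes the same value on all monomials of pole order `s`. -/
theorem eq_normal_monomial {F : Type*} [Field F] {L : ℕ → ℕ → ℕ → F} {s : ℕ}
    (hy : ∀ a b c, L a (b + 4) c = L (a + 3) b c + L (a + 1) b c)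
    (hz : ∀ a b c, L a b (c + 7) = L a (b + 9) c - L a (b + 1) c)
    (h0 : ∀ a b c, 28 * a + 21 * b + 27 * c < s → L a b c = 0) (a b c : ℕ)
    (h : 28 * a + 21 * b + 27 * c = s) :
    IsPoleOrder s ∧ L a b c = L (expX s) (expY s) (expZ s) := by
  induction c using Nat.strong_induction_on generalizing b with
  | _ c ihc =>
    rcases lt_or_ge c 7 with hc | hc
    · clear ihc
      induction b using Nat.strong_induction_on generalizing a with
      | _ b ihb =>
        rcases lt_or_ge b 4 with hb | hb
        · obtain ⟨h1, h2, h3⟩ := exps_of_weight (a := a) hb hc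
          rw [h] at h1 h2 h3
          unfold IsPoleOrder
          rw [h1, h2, h3]
          exact ⟨h, rfl⟩
        · obtain ⟨b, rfl⟩ := Nat.exists_eq_add_of_le' hb
          rw [hy, h0 (a + 1) b c (by omega), add_zero]
          exact ihb b (by omega) (a + 3) (by omega)
    · obtain ⟨c, rfl⟩ := Nat.exists_eq_add_of_le' hc
      rw [hz, h0 a (b + 1) c (by omega), sub_zero]
      exact ihc c (by omega) (b + 9) (by omega)

/-- Monomials separate points of affine space over a finite field. -/
theorem exists_monomial_sum_ne_zero {F ι : Type*} [Field F] [Fintype F] [Fintype ι]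
    {x y z : ι → F} (hinj : ∀ i j, x i = x j → y i = y j → z i = z j → i = j)
    {v : ι → F} (hv : v ≠ 0) :
    ∃ a b c : ℕ, ∑ i, v i * (x i ^ a * y i ^ b * z i ^ c) ≠ 0 := by
  classical
  by_contra! h
  apply hv
  ext j
  set P : ι → Fin 3 → F := fun i => ![x i, y i, z i] with hP
  have key : ∀ p : MvPolynomial (Fin 3) F, ∑ i, v i * MvPolynomial.eval (P i) p = 0 := by
    intro p
    simp_rw [MvPolynomial.eval_eq', Finset.mul_sum]
    rw [Finset.sum_comm]
    refine Finset.sum_eq_zero fun d _ => ?_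
    have := congrArg (fun t => MvPolynomial.coeff d p * t) (h (d 0) (d 1) (d 2))
    simp only [mul_zero, Finset.mul_sum] at this
    rw [← this]
    refine Finset.sum_congr rfl fun i _ => ?_
    simp only [hP, Fin.prod_univ_three, Matrix.cons_val]
    ring
  have := key (MvPolynomial.indicator (P j))
  rw [Finset.sum_eq_single j] at this
  · simpa [MvPolynomial.eval_indicator_apply_eq_one] using this
  · intro i _ hij
    rw [MvPolynomial.eval_indicator_apply_eq_zero, mul_zero]
    intro hPij
    exact hij (hinj i j (congrFun hPij 0) (congrFun hPij 1) (congrFun hPij 2))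
  · simp

theorem charP_three {F : Type*} [Field F] [Fintype F] (hF : Fintype.card F = 729) : CharP F 3 := by
  have : Fact (Nat.Prime 3) := ⟨Nat.prime_three⟩
  refine charP_of_card_eq_prime_pow (p := 3) (f := 6) ?_
  rw [hF]; norm_num

open Polynomial in
theorem card_z {F : Type*} [Field F] [Fintype F] [DecidableEq F]
    (hF : Fintype.card F = 729) :
    (Finset.univ.filter fun z : F => z ^ 225 + z ^ 169 + z = 0).card = 225 := by
  have := charP_three hF
  have h3 : (3 : F[X]) = 0 := by exact_mod_cast CharP.cast_eq_zero F[X] 3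
  have h := card_roots_of_dvd_X_pow_card_sub_X (F := F) (P := X ^ 225 + X ^ 169 + X) (by
    rw [hF]
    refine ⟨X ^ 504 - X ^ 448 + X ^ 392 - X ^ 336 + X ^ 224 + X ^ 168 - 1, ?_⟩
    linear_combination -X ^ 393 * h3)
  rw [show (X ^ 225 + X ^ 169 + X : F[X]).natDegree = 225 by compute_degree!] at h
  simpa using h

open Polynomial in
theorem card_y {F : Type*} [Field F] [Fintype F] [DecidableEq F]
    (hF : Fintype.card F = 729) {w : F} (hw : w ^ 81 + w ^ 9 + w = 0) :
    (Finset.univ.filter fun y : F => w = y ^ 9 - y).card = 9 := by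
  have := charP_three hF
  have : Fact (Nat.Prime 3) := ⟨Nat.prime_three⟩
  have h := card_roots_of_dvd_X_pow_card_sub_X (F := F) (P := X ^ 9 - X - C w) (by
    rw [hF]
    refine ⟨1 + (X ^ 9 - X - C w) ^ 8 + (X ^ 9 - X - C w) ^ 80, ?_⟩
    have e1 : (X ^ 9 - X - C w : F[X]) ^ 9 = (X ^ 9) ^ 9 - X ^ 9 - C w ^ 9 := by
      rw [show 9 = 3 ^ 2 by norm_num, sub_pow_char_pow, sub_pow_char_pow]
    have e2 : (X ^ 9 - X - C w : F[X]) ^ 81 = (X ^ 9) ^ 81 - X ^ 81 - C w ^ 81 := by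
      rw [show 81 = 3 ^ 4 by norm_num, sub_pow_char_pow, sub_pow_char_pow]
    have e3 : (C w ^ 81 + C w ^ 9 + C w : F[X]) = 0 := by
      simp only [← C_pow, ← C_add, hw, C_0]
    generalize hA : (X ^ 9 - X - C w : F[X]) = A at e1 e2
    linear_combination -e1 - e2 + hA + e3)
  rw [show (X ^ 9 - X - C w : F[X]).natDegree = 9 by compute_degree!] at h
  simpa only [eval_sub, eval_pow, eval_X, eval_C, sub_eq_zero, eq_comm (b := w)] using h

open Polynomial in
theorem card_x {F : Type*} [Field F] [Fintype F] [DecidableEq F]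
    (hF : Fintype.card F = 729) {t : F}
    (ht : t ^ 243 - t ^ 81 + t ^ 27 - t ^ 9 + t ^ 3 - t = 0) :
    (Finset.univ.filter fun x : F => t = x ^ 3 + x).card = 3 := by
  have := charP_three hF
  have : Fact (Nat.Prime 3) := ⟨Nat.prime_three⟩
  have h := card_roots_of_dvd_X_pow_card_sub_X (F := F) (P := X ^ 3 + X - C t) (by
    rw [hF]
    generalize hA : (X ^ 3 + X - C t : F[X]) = A
    refine ⟨A ^ 242 - A ^ 80 + A ^ 26 - A ^ 8 + A ^ 2 - 1, ?_⟩
    have e : ∀ n : ℕ, A ^ 3 ^ n = (X ^ 3) ^ 3 ^ n + X ^ 3 ^ n - C t ^ 3 ^ n := fun n => by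
      rw [← hA, sub_pow_char_pow, add_pow_char_pow]
    have e1 := e 1
    have e2 := e 2
    have e3 := e 3
    have e4 := e 4
    have e5 := e 5
    norm_num only [← pow_mul] at e1 e2 e3 e4 e5
    have e6 : (C t ^ 243 - C t ^ 81 + C t ^ 27 - C t ^ 9 + C t ^ 3 - C t : F[X]) = 0 := by
      simp only [← C_pow, ← C_add, ← C_sub, ht, C_0]
    linear_combination -e5 + e4 - e3 + e2 - e1 - hA + e6)
  rw [show (X ^ 3 + X - C t : F[X]).natDegree = 3 by compute_degree!] at h
  simpa only [eval_sub, eval_add, eval_pow, eval_X, eval_C, sub_eq_zero, eq_comm (b := t)] using h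

/-- The trace condition for `w = y ^ 9 - y`. -/
theorem trace_eq_zero {F : Type*} [Field F] (h3 : (3 : F) = 0) {w : F} (hw : w ^ 33 + w ^ 25 + w = 0) :
    w ^ 81 + w ^ 9 + w = 0 := by
  linear_combination (w ^ 48 - w ^ 40 + w ^ 32 - w ^ 24 + w ^ 8 + 1) * hw - w ^ 33 * h3

theorem solvable_x {F : Type*} [Field F] [Fintype F]
    (hF : Fintype.card F = 729) {y w : F} (hw : w ^ 33 + w ^ 25 + w = 0)
    (hy : w = y ^ 9 - y) :
    (y ^ 4) ^ 243 - (y ^ 4) ^ 81 + (y ^ 4) ^ 27 - (y ^ 4) ^ 9 + (y ^ 4) ^ 3 - y ^ 4 = 0 := by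
  have := charP_three hF
  have : Fact (Nat.Prime 3) := ⟨Nat.prime_three⟩
  have e0 : y ^ 9 = y + w := by rw [hy]; ring
  have e1 : y ^ 27 = y ^ 3 + w ^ 3 := by
    rw [← add_pow_char, ← e0, ← pow_mul]
  have e2 : y ^ 81 = y + w + w ^ 9 := by
    rw [show 81 = 9 * 3 ^ 2 by norm_num, pow_mul, e0, add_pow_char_pow]
    norm_num [e0]
  have e3 : y ^ 243 = y ^ 3 + w ^ 3 + w ^ 27 := by
    rw [show 243 = 9 * 3 ^ 3 by norm_num, pow_mul, e0, add_pow_char_pow]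
    norm_num [e1]
  have e4 : y ^ 729 = y := by rw [← hF]; exact FiniteField.pow_card y
  calc _ = y ^ 729 * y ^ 243 - y ^ 243 * y ^ 81 + y ^ 81 * y ^ 27 - y ^ 27 * y ^ 9
        + y ^ 9 * y ^ 3 - y ^ 3 * y := by ring
    _ = 0 := by
      rw [e4, e3, e2, e1, e0]
      linear_combination -w ^ 3 * hw

/-- The affine points of the curve `y ^ 4 = x ^ 3 + x`, `z ^ 7 = y ^ 9 - y`. -/
theorem exists_points {F : Type*} [Field F] [Fintype F] [DecidableEq F]
    (hF : Fintype.card F = 729) :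
    ∃ x y z : Fin 6075 → F, (∀ i j, x i = x j → y i = y j → z i = z j → i = j) ∧
      ∀ i, y i ^ 4 = x i ^ 3 + x i ∧ z i ^ 7 = y i ^ 9 - y i := by
  have := charP_three hF
  have h3 : (3 : F) = 0 := by exact_mod_cast CharP.cast_eq_zero F 3
  let S : Finset (Σ _ : F, Σ _ : F, F) :=
    (Finset.univ.filter fun z : F => z ^ 225 + z ^ 169 + z = 0).sigma fun z =>
      (Finset.univ.filter fun y : F => z ^ 7 = y ^ 9 - y).sigma fun y =>
        Finset.univ.filter fun x : F => y ^ 4 = x ^ 3 + x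
  have hw : ∀ z : F, z ^ 225 + z ^ 169 + z = 0 →
      (z ^ 7) ^ 33 + (z ^ 7) ^ 25 + z ^ 7 = 0 := fun z hz => by
    linear_combination z ^ 6 * hz
  have hS : S.card = 6075 := by
    rw [Finset.card_sigma, Finset.sum_congr rfl (g := fun _ => 27), Finset.sum_const, card_z hF]
    · rfl
    intro z hz
    have hz' := hw z (by simpa using hz)
    rw [Finset.card_sigma, Finset.sum_congr rfl (g := fun _ => 3), Finset.sum_const,
      card_y hF (trace_eq_zero h3 hz')]
    · rfl
    intro y hy
    exact card_x hF (solvable_x hF hz' (by simpa using hy))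
  let e := (S.equivFinOfCardEq hS).symm
  refine ⟨fun i => (e i).1.2.2, fun i => (e i).1.2.1, fun i => (e i).1.1, ?_, ?_⟩
  · intro i j hx hy hz
    apply e.injective
    apply Subtype.ext
    refine Sigma.ext hz (heq_of_eq (Sigma.ext hy (heq_of_eq hx)))
  · intro i
    have := (e i).2
    simp only [S, Finset.mem_sigma, Finset.mem_filter, Finset.mem_univ, true_and] at this
    exact ⟨this.2.2, this.2.1⟩

end GKCode

open GKCode in
theorem code_6075_5780_198
    (F : Type*) [Field F] [Fintype F] [DecidableEq F] (hF : Fintype.card F = 729) :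
    ∃ C : Submodule F (Fin 6075 → F),
      5780 ≤ Module.finrank F C ∧
      ∀ x ∈ C, x ≠ 0 → 198 ≤ hammingNorm x := by
  obtain ⟨x, y, z, hinj, heq⟩ := exists_points hF
  let f : ℕ → Fin 6075 → F := fun s i => x i ^ expX s * y i ^ expY s * z i ^ expZ s
  let T := (Finset.range 394).filter IsPoleOrder
  let Φ : (Fin 6075 → F) →ₗ[F] (T → F) :=
    Matrix.mulVecLin (Matrix.of fun (s : T) i => f s i)
  refine ⟨LinearMap.ker Φ, ?_, fun v hv hv0 => ?_⟩
  · have h1 := Φ.finrank_range_add_finrank_ker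
    have h2 := Submodule.finrank_le (LinearMap.range Φ)
    rw [Module.finrank_fintype_fun_eq_card, Fintype.card_coe] at h2
    rw [Module.finrank_fintype_fun_eq_card, Fintype.card_fin] at h1
    have h3 : T.card = 295 := card_poleOrders
    omega
  · let L : ℕ → ℕ → ℕ → F := fun a b c => ∑ i, v i * (x i ^ a * y i ^ b * z i ^ c)
    have hLy : ∀ a b c, L a (b + 4) c = L (a + 3) b c + L (a + 1) b c := fun a b c => by
      simp only [L, ← Finset.sum_add_distrib]
      refine Finset.sum_congr rfl fun i _ => ?_
      linear_combination v i * x i ^ a * y i ^ b * z i ^ c * (heq i).1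
    have hLz : ∀ a b c, L a b (c + 7) = L a (b + 9) c - L a (b + 1) c := fun a b c => by
      simp only [L, ← Finset.sum_sub_distrib]
      refine Finset.sum_congr rfl fun i _ => ?_
      linear_combination v i * x i ^ a * y i ^ b * z i ^ c * (heq i).2
    have hex : ∃ s a b c, 28 * a + 21 * b + 27 * c = s ∧ L a b c ≠ 0 := by
      obtain ⟨a, b, c, h⟩ := exists_monomial_sum_ne_zero hinj hv0
      exact ⟨_, a, b, c, rfl, h⟩
    classical
    obtain ⟨s, ⟨a₀, b₀, c₀, hs, hne⟩, hmin⟩ :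
        ∃ s, (∃ a b c, 28 * a + 21 * b + 27 * c = s ∧ L a b c ≠ 0) ∧
          ∀ a b c, 28 * a + 21 * b + 27 * c < s → L a b c = 0 :=
      ⟨Nat.find hex, Nat.find_spec hex, fun a b c h => by
        by_contra hne
        exact Nat.find_min hex h ⟨a, b, c, rfl, hne⟩⟩
    have hnormal := eq_normal_monomial hLy hLz hmin
    have hsL : L (expX s) (expY s) (expZ s) ≠ 0 := (hnormal _ _ _ hs).2 ▸ hne
    have hs394 : 394 ≤ s := by
      by_contra! hlt
      have hsT : s ∈ T := by
        simp only [T, Finset.mem_filter, Finset.mem_range]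
        exact ⟨hlt, (hnormal _ _ _ hs).1⟩
      apply hsL
      refine Eq.trans ?_ (congrFun (LinearMap.mem_ker.1 hv) ⟨s, hsT⟩)
      simp only [Φ, Matrix.mulVecLin_apply, Matrix.mulVec, dotProduct, Matrix.of_apply, L, f]
      exact Finset.sum_congr rfl fun i _ => mul_comm _ _
    refine (le_card_decompositions hs394).trans
      (card_le_hammingNorm _ v f (fun a => f (s - a)) ?_ ?_)
    all_goals
      have hprod : ∀ a b, ∑ i, v i * (f a i * f b i) =
          L (expX a + expX b) (expY a + expY b) (expZ a + expZ b) := fun a b =>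
        Finset.sum_congr rfl fun i _ => by simp only [f]; ring
      simp only [Finset.mem_filter, Finset.mem_range]
    · rintro a ⟨ha, ha1, ha2⟩
      unfold IsPoleOrder at ha1 ha2
      rw [hprod, (hnormal _ _ _ (by omega)).2]
      exact hsL
    · rintro a ⟨ha, ha1, -⟩ b ⟨hb, -, hb2⟩ hab
      unfold IsPoleOrder at ha1 hb2
      rw [hprod]
      exact hmin _ _ _ (by omega)
end
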